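/- arXiv:1506.01528 — 4 statements merged into one kernel-verified Lean document; each statement's English description precedes it below -/
import Mathlib

section
/- Let L = ⋃_{i=0}^{m₀} K_i be a compact subset of ℂ with connected complement, where m₀ ≥ 1 and K₀, …, K_{m₀} are the connected components of L, K₀ has nonempty interior, and each K_i with 1 ≤ i ≤ m₀ contains more than one point. Let Π := L ∖ K₀, fix z₀ in the interior of K₀, and let (β_n)_{n≥1} be a sequence of complex numbers such that (|β_n|^{1/n})_{n≥1} has a limit point in the open interval (ρ_L, 1/ρ_L). Then for every nonzero complex polynomial u with coefficients in ℚ + iℚ and every integer s ≥ 1, the set ⋃_{n≥1} V(u,s,n), where V(u,s,n) := { f ∈ A(K₀) : ‖β_n·S_n(f,z₀) − u‖_Π < 1/s }, is dense in (A(K₀), ‖·‖_{K₀}). -/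
open Filter Topology Metric

/-- The `n`-th partial sum of the Taylor series of `f` at `z₀`:
`S_n(f,z₀)(z) = Σ_{k=0}^{n} (f^{(k)}(z₀)/k!)·(z−z₀)^k`. -/
noncomputable def taylorSum (f : ℂ → ℂ) (z₀ : ℂ) (n : ℕ) (z : ℂ) : ℂ :=
  ∑ k ∈ Finset.range (n + 1), (iteratedDeriv k f z₀ / (Nat.factorial k)) * (z - z₀) ^ k

/-- Supremum norm of `g` on `X`. -/
noncomputable def supNorm (g : ℂ → ℂ) (X : Set ℂ) : ℝ :=
  sSup ((fun z => ‖g z‖) '' X)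

/-- Membership in `A(X)`: continuous on `X` and holomorphic on the interior of `X`. -/
def memA (X : Set ℂ) (f : ℂ → ℂ) : Prop :=
  ContinuousOn f X ∧ DifferentiableOn ℂ f (interior X)

/-- Best sup-norm approximation error of `G` on `L` by polynomials of degree at most `n`. -/
noncomputable def dApprox (L : Set ℂ) (G : ℂ → ℂ) (n : ℕ) : ℝ :=
  sInf {c : ℝ | ∃ p : Polynomial ℂ, p.degree ≤ (n : ℕ) ∧
    c = supNorm (fun z => G z - Polynomial.eval z p) L}

/-- The asymptotic quantity `limsup_n d_n(G)^{1/n}`; for a function `G` which is equal to a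
different polynomial on each connected component of `L` this is the asymptotic convergence
factor `ρ_L` of `L`. -/
noncomputable def rho (L : Set ℂ) (G : ℂ → ℂ) : ℝ :=
  Filter.limsup (fun n : ℕ => dApprox L G n ^ (1 / (n : ℝ))) Filter.atTop

/-- `W` is open in the subspace `A(X)`, with respect to the sup-norm on `X`. -/
def openInA (X : Set ℂ) (W : Set (ℂ → ℂ)) : Prop :=
  ∀ f ∈ W, memA X f →
    ∃ ε > (0:ℝ), ∀ g : ℂ → ℂ, memA X g → supNorm (fun z => g z - f z) X < ε → g ∈ W

/-- `S` is dense in `A(X)`, with respect to the sup-norm on `X`. -/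
def denseInA (X : Set ℂ) (S : Set (ℂ → ℂ)) : Prop :=
  ∀ g : ℂ → ℂ, memA X g → ∀ ε : ℝ, 0 < ε → ∃ f ∈ S, supNorm (fun z => f z - g z) X < ε

/-- A polynomial with coefficients in `ℚ + iℚ`. -/
def ratCoeffs (u : Polynomial ℂ) : Prop :=
  ∀ k : ℕ, ∃ q r : ℚ, u.coeff k = (q : ℂ) + (r : ℂ) * Complex.I

/-- The set `V(u, s, n) = {f ∈ A(K₀) : ‖β_n · S_n(f, z₀) − u‖_Π < 1/s}`. -/
def Vset (z₀ : ℂ) (K₀ P : Set ℂ) (β : ℕ → ℂ) (u : Polynomial ℂ) (s n : ℕ) : Set (ℂ → ℂ) :=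
  {f | memA K₀ f ∧
    supNorm (fun z => β n * taylorSum f z₀ n z - Polynomial.eval z u) P < 1 / (s : ℝ)}

open MeasureTheory

/-- Uniform approximability by polynomials on `K`. -/
def PA (K : Set ℂ) (f : ℂ → ℂ) : Prop :=
  ∀ ε > (0 : ℝ), ∃ p : Polynomial ℂ, ∀ z ∈ K, ‖f z - p.eval z‖ ≤ ε

lemma PA.congr {K : Set ℂ} {f g : ℂ → ℂ} (hf : PA K f) (h : ∀ z ∈ K, f z = g z) : PA K g := by
  intro ε hε
  obtain ⟨p, hp⟩ := hf ε hε
  exact ⟨p, fun z hz => by rw [← h z hz]; exact hp z hz⟩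

lemma PA.poly (K : Set ℂ) (p : Polynomial ℂ) : PA K (fun z => p.eval z) := by
  intro ε hε
  exact ⟨p, fun z _ => by simp [hε.le]⟩

lemma PA.const (K : Set ℂ) (c : ℂ) : PA K (fun _ => c) :=
  (PA.poly K (Polynomial.C c)).congr (by simp)

lemma PA.id (K : Set ℂ) : PA K (fun z => z) :=
  (PA.poly K (Polynomial.X)).congr (by simp)

lemma PA.add {K : Set ℂ} {f g : ℂ → ℂ} (hf : PA K f) (hg : PA K g) :
    PA K (fun z => f z + g z) := by
  intro ε hε
  obtain ⟨p, hp⟩ := hf (ε / 2) (by positivity)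
  obtain ⟨q, hq⟩ := hg (ε / 2) (by positivity)
  refine ⟨p + q, fun z hz => ?_⟩
  have : f z + g z - (p + q).eval z = (f z - p.eval z) + (g z - q.eval z) := by
    simp; ring
  rw [this]
  refine (norm_add_le _ _).trans ?_
  linarith [hp z hz, hq z hz]

lemma PA.lim {K : Set ℂ} {f : ℂ → ℂ} (h : ∀ ε > (0 : ℝ), ∃ g, PA K g ∧ ∀ z ∈ K, ‖f z - g z‖ ≤ ε) :
    PA K f := by
  intro ε hε
  obtain ⟨g, hg, hfg⟩ := h (ε / 2) (by positivity)
  obtain ⟨q, hq⟩ := hg (ε / 2) (by positivity)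
  refine ⟨q, fun z hz => ?_⟩
  have : f z - q.eval z = (f z - g z) + (g z - q.eval z) := by ring
  rw [this]
  refine (norm_add_le _ _).trans ?_
  linarith [hfg z hz, hq z hz]

lemma poly_bdd {K : Set ℂ} (hK : IsCompact K) (p : Polynomial ℂ) :
    ∃ C : ℝ, 0 < C ∧ ∀ z ∈ K, ‖p.eval z‖ ≤ C := by
  obtain ⟨C, hC⟩ := hK.exists_bound_of_continuousOn (f := fun z => p.eval z)
    p.continuous.continuousOn
  exact ⟨max C 1, by positivity, fun z hz => (hC z hz).trans (le_max_left _ _)⟩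

lemma PA.bdd {K : Set ℂ} (hK : IsCompact K) {f : ℂ → ℂ} (hf : PA K f) :
    ∃ C : ℝ, 0 < C ∧ ∀ z ∈ K, ‖f z‖ ≤ C := by
  obtain ⟨p, hp⟩ := hf 1 one_pos
  obtain ⟨C, hC, h⟩ := poly_bdd hK p
  refine ⟨1 + C, by positivity, fun z hz => ?_⟩
  have : f z = (f z - p.eval z) + p.eval z := by ring
  rw [this]
  exact (norm_add_le _ _).trans (add_le_add (hp z hz) (h z hz))

lemma PA.mul {K : Set ℂ} (hK : IsCompact K) {f g : ℂ → ℂ} (hf : PA K f) (hg : PA K g) :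
    PA K (fun z => f z * g z) := by
  intro ε hε
  obtain ⟨C, hC, hfC⟩ := hf.bdd hK
  obtain ⟨q, hq⟩ := hg (ε / 2 / C) (by positivity)
  obtain ⟨D, hD, hqD⟩ := poly_bdd hK q
  obtain ⟨p, hp⟩ := hf (ε / 2 / D) (by positivity)
  refine ⟨p * q, fun z hz => ?_⟩
  have : f z * g z - (p * q).eval z = f z * (g z - q.eval z) + (f z - p.eval z) * q.eval z := by
    simp; ring
  rw [this]
  refine (norm_add_le _ _).trans ?_
  rw [norm_mul, norm_mul]
  have h1 : ‖f z‖ * ‖g z - q.eval z‖ ≤ C * (ε / 2 / C) :=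
    mul_le_mul (hfC z hz) (hq z hz) (norm_nonneg _) hC.le
  have h2 : ‖f z - p.eval z‖ * ‖q.eval z‖ ≤ (ε / 2 / D) * D :=
    mul_le_mul (hp z hz) (hqD z hz) (norm_nonneg _) (by positivity)
  have h3 : C * (ε / 2 / C) = ε / 2 := by field_simp
  have h4 : (ε / 2 / D) * D = ε / 2 := by field_simp
  linarith

lemma PA.pow {K : Set ℂ} (hK : IsCompact K) {f : ℂ → ℂ} (hf : PA K f) (n : ℕ) :
    PA K (fun z => f z ^ n) := by
  induction n with
  | zero => simpa using PA.const K 1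
  | succ n ih => simpa [pow_succ] using ih.mul hK hf

lemma PA.cmul {K : Set ℂ} (hK : IsCompact K) {f : ℂ → ℂ} (c : ℂ) (hf : PA K f) :
    PA K (fun z => c * f z) := (PA.const K c).mul hK hf

lemma PA.sum {K : Set ℂ} {ι : Type*} (s : Finset ι) {f : ι → ℂ → ℂ}
    (hf : ∀ i ∈ s, PA K (f i)) : PA K (fun z => ∑ i ∈ s, f i z) := by
  classical
  induction s using Finset.induction_on with
  | empty => simpa using PA.const K 0
  | insert a s ha ih =>
    simp only [Finset.sum_insert ha]
    exact (hf a (by simp)).add (ih fun i hi => hf i (by simp [hi]))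

/-- Composition with a holomorphic function on a disc. -/
lemma PA.comp {K : Set ℂ} (hK : IsCompact K) {v G : ℂ → ℂ} (hv : PA K v)
    (hG : DifferentiableOn ℂ G (closedBall 0 (3/4))) (hb : ∀ z ∈ K, ‖v z‖ < 2/3) :
    PA K (fun z => G (v z)) := by
  have h1 := DifferentiableOn.hasFPowerSeriesOnBall (R := 3/4) (c := 0) (f := G)
    (by simpa using hG) (by norm_num)
  have h2 := h1.tendstoUniformlyOn' (r' := 2/3) (by
    rw [ENNReal.coe_lt_coe, ← NNReal.coe_lt_coe]; push_cast; norm_num)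
  rw [Metric.tendstoUniformlyOn_iff] at h2
  apply PA.lim
  intro ε hε
  obtain ⟨n, hn⟩ := (h2 ε hε).exists
  set p := cauchyPowerSeries G 0 ((3/4 : NNReal) : ℝ)
  refine ⟨fun z => ∑ k ∈ Finset.range n, p.coeff k * v z ^ k, ?_, ?_⟩
  · exact PA.sum _ fun k _ => (hv.pow hK k).cmul hK _
  · intro z hz
    have := hn (v z) (by simpa using hb z hz)
    rw [dist_eq_norm] at this
    simp only [FormalMultilinearSeries.partialSum, sub_zero,
      FormalMultilinearSeries.apply_eq_pow_smul_coeff, smul_eq_mul] at this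
    refine le_of_lt ?_
    have e : ∑ k ∈ Finset.range n, p.coeff k * v z ^ k
        = ∑ k ∈ Finset.range n, v z ^ k * p.coeff k :=
      Finset.sum_congr rfl fun _ _ => mul_comm _ _
    simp only [e]
    exact this

lemma PA.inv_step {K : Set ℂ} (hK : IsCompact K) {x y : ℂ} {d : ℝ} (hd : 0 < d)
    (hx : ∀ z ∈ K, d ≤ ‖z - x‖) (hxy : ‖y - x‖ < d / 2)
    (h : PA K (fun z => (z - x)⁻¹)) : PA K (fun z => (z - y)⁻¹) := by
  have h1 : PA K (fun z => (y - x) * (z - x)⁻¹) := h.cmul hK _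
  have h2 : PA K (fun z => (1 - (y - x) * (z - x)⁻¹)⁻¹) := by
    refine PA.comp hK (G := fun w => (1 - w)⁻¹) h1 ?_ ?_
    · intro w hw
      apply DifferentiableAt.differentiableWithinAt
      apply DifferentiableAt.inv (by fun_prop)
      intro h0
      have : w = 1 := by linear_combination -h0
      rw [this] at hw
      simp at hw
      norm_num at hw
    · intro z hz
      have hp : 0 < ‖z - x‖ := hd.trans_le (hx z hz)
      rw [norm_mul, norm_inv, ← div_eq_mul_inv, div_lt_iff₀ hp]
      linarith [hx z hz]
  refine (h.mul hK h2).congr fun z hz => ?_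
  have hp : 0 < ‖z - x‖ := hd.trans_le (hx z hz)
  have hzx : z - x ≠ 0 := norm_pos_iff.mp hp
  rw [← mul_inv]
  congr 1
  field_simp
  ring

lemma dist_compl {K : Set ℂ} (hK : IsCompact K) {x : ℂ} (hx : x ∉ K) :
    ∃ d > 0, ∀ z ∈ K, d ≤ ‖z - x‖ := by
  have : Kᶜ ∈ 𝓝 x := hK.isClosed.isOpen_compl.mem_nhds hx
  obtain ⟨d, hd, h⟩ := Metric.mem_nhds_iff.mp this
  refine ⟨d, hd, fun z hz => ?_⟩
  by_contra hlt
  push Not at hlt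
  exact h (by simpa [dist_eq_norm] using hlt) hz

lemma PA.inv {K : Set ℂ} (hK : IsCompact K) (hc : IsPreconnected Kᶜ) {y : ℂ} (hy : y ∉ K) :
    PA K (fun z => (z - y)⁻¹) := by
  obtain ⟨R, hR, hKR⟩ := hK.isBounded.exists_pos_norm_le
  have hx0 : ((2 * R : ℝ) : ℂ) ∉ K := by
    intro h
    have := hKR _ h
    rw [Complex.norm_real, Real.norm_of_nonneg (by positivity)] at this
    linarith
  have base : PA K (fun z => (z - ((2 * R : ℝ) : ℂ))⁻¹) := by
    have hR' : ((2 * R : ℝ) : ℂ) ≠ 0 := by exact_mod_cast (by positivity : (2 * R : ℝ) ≠ 0)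
    have h1 : PA K (fun z => ((2 * R : ℝ) : ℂ)⁻¹ * z) := (PA.id K).cmul hK _
    have h2 : PA K (fun z => (1 - ((2 * R : ℝ) : ℂ)⁻¹ * z)⁻¹) := by
      refine PA.comp hK (G := fun w => (1 - w)⁻¹) h1 ?_ ?_
      · intro w hw
        apply DifferentiableAt.differentiableWithinAt
        apply DifferentiableAt.inv (by fun_prop)
        intro h0
        have : w = 1 := by linear_combination -h0
        rw [this] at hw
        simp at hw
        norm_num at hw
      · intro z hz
        rw [norm_mul, norm_inv, Complex.norm_real, Real.norm_of_nonneg (by positivity),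
          inv_mul_lt_iff₀ (by positivity)]
        linarith [hKR z hz]
    refine (h2.cmul hK (-((2 * R : ℝ) : ℂ)⁻¹)).congr fun z hz => ?_
    rw [← inv_neg, ← mul_inv]
    congr 1
    field_simp
    ring
  have key := hc.induction₂ (fun x y => PA K (fun z => (z - x)⁻¹) ↔ PA K (fun z => (z - y)⁻¹))
    (by
      intro x hx
      obtain ⟨d, hd, hdK⟩ := dist_compl hK hx
      apply Filter.Eventually.filter_mono nhdsWithin_le_nhds
      filter_upwards [Metric.ball_mem_nhds x (show 0 < d / 4 by positivity)] with y hy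
      rw [Metric.mem_ball, dist_eq_norm] at hy
      constructor
      · exact PA.inv_step hK hd hdK (by linarith)
      · refine PA.inv_step hK (d := d * 3 / 4) (by positivity) (fun z hz => ?_) ?_
        · have := norm_sub_le_norm_sub_add_norm_sub z y x
          linarith [hdK z hz]
        · rw [norm_sub_rev]; linarith)
    (by intro x y z _ _ _ h1 h2; exact h1.trans h2)
    (by intro x y _ _ h; exact h.symm) hx0 hy
  exact key.mp base

/-- Square-root relation between two poles. -/
def SqRel (K : Set ℂ) (a x y : ℂ) : Prop :=
  ∃ w : ℂ → ℂ, PA K w ∧ ContinuousOn w (ball a 2)ᶜ ∧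
    (∀ z ∈ K ∪ (ball a 2)ᶜ, w z ^ 2 * (z - y) = z - x) ∧ Tendsto w (cocompact ℂ) (𝓝 1)

lemma SqRel.step {K : Set ℂ} (hK : IsCompact K) (hc : IsPreconnected Kᶜ) {a x y : ℂ} {d : ℝ}
    (hd : 0 < d) (hy : ∀ z ∈ K ∪ (ball a 2)ᶜ, d ≤ ‖z - y‖) (hxy : ‖x - y‖ < d / 2) :
    SqRel K a x y := by
  have hyK : y ∉ K := fun h => by
    have := hy y (Or.inl h)
    simp at this
    linarith
  have hb : ∀ z ∈ K ∪ (ball a 2)ᶜ, ‖(x - y) * (z - y)⁻¹‖ < 2 / 3 := by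
    intro z hz
    have hp : 0 < ‖z - y‖ := hd.trans_le (hy z hz)
    rw [norm_mul, norm_inv, ← div_eq_mul_inv, div_lt_iff₀ hp]
    linarith [hy z hz]
  have hslit : ∀ v : ℂ, ‖v‖ ≤ 3 / 4 → 1 - v ∈ Complex.slitPlane := by
    intro v hv
    left
    have := (Complex.re_le_norm v).trans hv
    simp only [Complex.sub_re, Complex.one_re]
    linarith
  refine ⟨fun z => (1 - (x - y) * (z - y)⁻¹) ^ (((2 : ℕ) : ℂ)⁻¹), ?_, ?_, ?_, ?_⟩
  · refine PA.comp hK (G := fun v => (1 - v) ^ (((2 : ℕ) : ℂ)⁻¹))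
      ((PA.inv hK hc hyK).cmul hK (x - y)) ?_ (fun z hz => hb z (Or.inl hz))
    intro v hv
    apply DifferentiableAt.differentiableWithinAt
    refine DifferentiableAt.cpow (by fun_prop) (by fun_prop) (hslit v (by simpa using hv))
  · intro z hz
    apply ContinuousAt.continuousWithinAt
    have hp : 0 < ‖z - y‖ := hd.trans_le (hy z (Or.inr hz))
    have hzx : z - y ≠ 0 := norm_pos_iff.mp hp
    refine ContinuousAt.cpow ?_ continuousAt_const (hslit _ ?_)
    · fun_prop (disch := assumption)
    · linarith [hb z (Or.inr hz)]
  · intro z hz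
    have hp : 0 < ‖z - y‖ := hd.trans_le (hy z hz)
    have hzx : z - y ≠ 0 := norm_pos_iff.mp hp
    simp only
    rw [Complex.cpow_nat_inv_pow _ (by norm_num)]
    field_simp
    ring
  · have h1 : Tendsto (fun z : ℂ => 1 - (x - y) * (z - y)⁻¹) (cocompact ℂ) (𝓝 1) := by
      have h2 : Tendsto (fun z : ℂ => (z - y)⁻¹) (cocompact ℂ) (𝓝 0) := by
        have := (Homeomorph.subRight y).isClosedEmbedding.tendsto_cocompact
        have h0 : Tendsto (Inv.inv : ℂ → ℂ) (cocompact ℂ) (𝓝 0) := by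
          rw [← Metric.cobounded_eq_cocompact]
          exact tendsto_inv₀_cobounded
        exact h0.comp this
      simpa using (h2.const_mul (x - y)).const_sub 1
    have h3 : ContinuousAt (fun v : ℂ => v ^ (((2 : ℕ) : ℂ)⁻¹)) 1 :=
      ContinuousAt.cpow continuousAt_id continuousAt_const (by simp)
    have := h3.tendsto.comp h1
    simpa [Function.comp_def] using this

lemma SqRel.all {K : Set ℂ} (hK : IsCompact K) (hc : IsPreconnected Kᶜ) {a : ℂ} {S : Set ℂ}
    (hS : IsPreconnected S) (hSK : ∀ x ∈ S, x ∉ K ∧ ‖x - a‖ ≤ 1) {x y : ℂ}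
    (hx : x ∈ S) (hy : y ∈ S) : SqRel K a x y := by
  refine hS.induction₂' (SqRel K a) ?_ ?_ hx hy
  · intro x hx
    obtain ⟨d0, hd0, hd0K⟩ := dist_compl hK (hSK x hx).1
    set d := min d0 1 with hdd
    have hd : 0 < d := by positivity
    have hx : ∀ z ∈ K ∪ (ball a 2)ᶜ, d ≤ ‖z - x‖ := by
      rintro z (hz | hz)
      · exact (min_le_left _ _).trans (hd0K z hz)
      · refine (min_le_right _ _).trans ?_
        simp [dist_eq_norm] at hz
        have := norm_sub_le_norm_sub_add_norm_sub z x a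
        linarith [(hSK x hx).2]
    apply Filter.Eventually.filter_mono nhdsWithin_le_nhds
    filter_upwards [Metric.ball_mem_nhds x (show 0 < d / 4 by positivity)] with y hy
    rw [Metric.mem_ball, dist_eq_norm] at hy
    constructor
    · refine SqRel.step hK hc (d := d * 3 / 4) (by positivity) (fun z hz => ?_) ?_
      · have := norm_sub_le_norm_sub_add_norm_sub z y x
        linarith [hx z hz]
      · rw [norm_sub_rev]; linarith
    · exact SqRel.step hK hc hd hx (by linarith)
  · rintro x y z hx hy hz ⟨w1, p1, c1, e1, t1⟩ ⟨w2, p2, c2, e2, t2⟩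
    refine ⟨fun z => w1 z * w2 z, p1.mul hK p2, c1.mul c2, fun u hu => ?_, ?_⟩
    · have h1 := e1 u hu
      have h2 := e2 u hu
      simp only
      rw [mul_pow]
      linear_combination h1 + w1 u ^ 2 * h2
    · simpa using t1.mul t2

lemma exit_set {K : Set ℂ} (hK : IsCompact K) (hc : IsConnected Kᶜ) {a : ℂ} (ha : a ∉ K) :
    ∃ (b : ℂ) (S : Set ℂ), IsPreconnected S ∧ (∀ x ∈ S, x ∉ K ∧ ‖x - a‖ ≤ 1) ∧ a ∈ S ∧ b ∈ S ∧
      ‖b - a‖ = 1 := by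
  have hpc := (hK.isClosed.isOpen_compl.isConnected_iff_isPathConnected).mp hc
  obtain ⟨R, hR, hKR⟩ := hK.isBounded.exists_pos_norm_le
  set f : ℂ := ((R + ‖a‖ + 2 : ℝ) : ℂ)
  have hnf : ‖f‖ = R + ‖a‖ + 2 := by
    rw [Complex.norm_real, Real.norm_of_nonneg (by positivity)]
  have hf : f ∈ Kᶜ := by
    intro h
    have := hKR _ h
    linarith [norm_nonneg a]
  obtain ⟨γ, hγ⟩ := hpc.joinedIn a ha f hf
  set φ : ℝ → ℝ := fun t => ‖γ.extend t - a‖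
  have hφ : Continuous φ := by
    have := γ.continuous_extend
    fun_prop
  have hφ0 : φ 0 = 0 := by simp [φ]
  have hφ1 : 1 ≤ φ 1 := by
    simp only [φ, Path.extend_one]
    have := norm_sub_norm_le f a
    linarith
  have hne : (Set.Icc (0:ℝ) 1 ∩ φ ⁻¹' {1}).Nonempty := by
    have := intermediate_value_Icc (zero_le_one (α := ℝ)) hφ.continuousOn
    obtain ⟨t, ht, h⟩ := this (show (1:ℝ) ∈ Set.Icc (φ 0) (φ 1) from ⟨by rw [hφ0]; norm_num, hφ1⟩)
    exact ⟨t, ht, h⟩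
  have hcomp : IsCompact (Set.Icc (0:ℝ) 1 ∩ φ ⁻¹' {1}) :=
    isCompact_Icc.inter_right (isClosed_singleton.preimage hφ)
  obtain ⟨t1, ⟨ht1, h1⟩, hmin⟩ := hcomp.exists_isLeast hne
  refine ⟨γ.extend t1, γ.extend '' Set.Icc 0 t1, ?_, ?_, ?_, ?_, h1⟩
  · exact isPreconnected_Icc.image _ γ.continuous_extend.continuousOn
  · rintro _ ⟨t, ht, rfl⟩
    have ht01 : t ∈ Set.Icc (0:ℝ) 1 := ⟨ht.1, ht.2.trans ht1.2⟩
    constructor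
    · rw [γ.extend_apply ht01]
      exact hγ _
    · by_contra hgt
      push Not at hgt
      have := intermediate_value_Icc ht.1 hφ.continuousOn
      obtain ⟨t', ht', h'⟩ := this (show (1:ℝ) ∈ Set.Icc (φ 0) (φ t) from
        ⟨by rw [hφ0]; norm_num, hgt.le⟩)
      have h3 := hmin ⟨⟨ht'.1, ht'.2.trans ht01.2⟩, h'⟩
      have : t = t1 := le_antisymm ht.2 (h3.trans ht'.2)
      rw [this] at hgt
      have h1' : ‖γ.extend t1 - a‖ = 1 := h1
      linarith
  · exact ⟨0, ⟨le_rfl, ht1.1⟩, by simp⟩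
  · exact ⟨t1, ⟨ht1.1, le_rfl⟩, rfl⟩

lemma kernel {K : Set ℂ} (hK : IsCompact K) (hc : IsConnected Kᶜ) {a : ℂ} (ha : a ∉ K) :
    ∃ (h : ℂ → ℂ) (c : ℂ), PA K h ∧ ‖c - a‖ ≤ 1 ∧ (∀ z ∈ K, ‖z - c‖ ≤ 10 → ‖h z‖ ≤ 168) ∧
      (∀ z ∈ K, 10 ≤ ‖z - c‖ → ‖h z - (z - c)⁻¹‖ ≤ 1 / ‖z - c‖ ^ 3) := by
  obtain ⟨b, S, hS, hSK, haS, hbS, hab⟩ := exit_set hK hc ha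
  obtain ⟨w, hwP, hwc, hwe, hwt⟩ := SqRel.all hK hc.isPreconnected hS hSK haS hbS
  set c := (a + b) / 2 with hcdef
  set d := (a - b) / 2 with hddef
  have hd : ‖d‖ = 1 / 2 := by
    rw [hddef, norm_div, norm_sub_rev, hab]; simp
  have hd0 : d ≠ 0 := by rw [← norm_pos_iff, hd]; norm_num
  have hca : ‖c - a‖ ≤ 1 := by
    have : c - a = -d := by rw [hcdef, hddef]; ring
    rw [this, norm_neg, hd]; norm_num
  have hs2 : ∀ z ∈ K ∪ (ball a 2)ᶜ, (w z * (z - b)) ^ 2 = (z - c) ^ 2 - d ^ 2 := by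
    intro z hz
    have := hwe z hz
    have e : (z - c) ^ 2 - d ^ 2 = (z - a) * (z - b) := by rw [hcdef, hddef]; ring
    rw [e]
    linear_combination (z - b) * this
  refine ⟨fun z => 2 / d ^ 2 * (z + -c + (-1) * (w z * (z + -b))), c, ?_, hca, ?_, ?_⟩
  · have hb : PA K (fun z => z + -b) := (PA.id K).add (PA.const K _)
    exact (((PA.id K).add (PA.const K _)).add ((hwP.mul hK hb).cmul hK (-1))).cmul hK _
  · intro z hz hz10
    simp only [← sub_eq_add_neg]
    have h1 : ‖w z * (z - b)‖ ≤ 11 := by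
      have h2 := hs2 z (Or.inl hz)
      have h3 : ‖w z * (z - b)‖ ^ 2 ≤ 10 ^ 2 + (1/2) ^ 2 := by
        rw [← norm_pow, h2]
        refine (norm_sub_le _ _).trans ?_
        rw [norm_pow, norm_pow, hd]
        gcongr
      nlinarith [norm_nonneg (w z * (z - b))]
    rw [norm_mul, norm_div, norm_pow, hd]
    have h2 : ‖z - c + -1 * (w z * (z - b))‖ ≤ 21 := by
      refine (norm_add_le _ _).trans ?_
      rw [norm_mul]; simp only [norm_neg, norm_one, one_mul]; linarith
    simp only [Complex.norm_ofNat]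
    linarith
  · -- far estimate
    intro z hz hz10
    have hfar : ∀ u : ℂ, 10 ≤ ‖u - c‖ → u ∈ (ball a 2)ᶜ := by
      intro u hu
      simp only [Set.mem_compl_iff, mem_ball, dist_eq_norm, not_lt]
      have := norm_sub_le_norm_sub_add_norm_sub u a c
      rw [norm_sub_rev a c] at this
      linarith
    set t : ℂ → ℂ := fun u => w u * (u - b) / (u - c) with ht
    have ht2 : ∀ u : ℂ, 10 ≤ ‖u - c‖ → t u ^ 2 = 1 - d ^ 2 / (u - c) ^ 2 := by
      intro u hu
      have huc : u - c ≠ 0 := by rw [← norm_pos_iff]; linarith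
      simp only [ht, div_pow]
      rw [hs2 u (Or.inr (hfar u hu))]
      field_simp
    have htre : ∀ u : ℂ, 10 ≤ ‖u - c‖ → (t u).re ≠ 0 := by
      intro u hu h0
      have h1 := congrArg Complex.re (ht2 u hu)
      have h2 : (t u ^ 2).re = - (t u).im ^ 2 := by
        rw [sq, Complex.mul_re, h0]; ring
      have h3 : ‖d ^ 2 / (u - c) ^ 2‖ ≤ 1 / 400 := by
        rw [norm_div, norm_pow, norm_pow, hd]
        rw [div_le_div_iff₀ (by positivity) (by norm_num)]
        nlinarith
      have h4 := (Complex.re_le_norm _).trans h3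
      rw [h2] at h1
      simp only [Complex.sub_re, Complex.one_re] at h1
      nlinarith [sq_nonneg (t u).im]
    have hzc : 0 < ‖z - c‖ := by linarith
    have hpos : 0 < (t z).re := by
      set ray : ℝ → ℂ := fun τ => c + (τ : ℂ) * (z - c) with hray
      have hrn : ∀ τ ∈ Set.Ici (1:ℝ), 10 ≤ ‖ray τ - c‖ := by
        intro τ hτ
        have hτ : (1:ℝ) ≤ τ := hτ
        simp only [hray, add_sub_cancel_left, norm_mul, Complex.norm_real,
          Real.norm_of_nonneg (zero_le_one.trans hτ)]
        nlinarith
      have hrayc : Continuous ray := by fun_prop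
      have hcont : ContinuousOn (fun τ => (t (ray τ)).re) (Set.Ici 1) := by
        refine Complex.continuous_re.comp_continuousOn ?_
        simp only [ht]
        refine ContinuousOn.div ?_ (by fun_prop) ?_
        · refine ContinuousOn.mul ?_ (by fun_prop)
          exact hwc.comp hrayc.continuousOn (fun τ hτ => hfar _ (hrn τ hτ))
        · intro τ hτ
          rw [← norm_pos_iff]; linarith [hrn τ hτ]
      have hrt : Tendsto ray atTop (cocompact ℂ) := by
        rw [← Metric.cobounded_eq_cocompact, ← tendsto_norm_atTop_iff_cobounded]
        refine tendsto_atTop_mono' atTop (f₁ := fun τ : ℝ => τ * ‖z - c‖ - ‖c‖) ?_ ?_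
        · filter_upwards [eventually_ge_atTop 0] with τ hτ
          have h1 : ‖(τ : ℂ) * (z - c)‖ = τ * ‖z - c‖ := by
            rw [norm_mul, Complex.norm_real, Real.norm_of_nonneg hτ]
          have h2 := norm_sub_le (ray τ) c
          have h3 : ray τ - c = (τ : ℂ) * (z - c) := by simp [hray]
          rw [h3, h1] at h2
          linarith
        · exact tendsto_atTop_add_const_right _ _ (tendsto_id.atTop_mul_const hzc)
      have htl : Tendsto t (cocompact ℂ) (𝓝 1) := by
        have h1 : Tendsto (fun u : ℂ => 1 + (c - b) * (u - c)⁻¹) (cocompact ℂ) (𝓝 1) := by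
          have h2 : Tendsto (fun z : ℂ => (z - c)⁻¹) (cocompact ℂ) (𝓝 0) := by
            have := (Homeomorph.subRight c).isClosedEmbedding.tendsto_cocompact
            have h0 : Tendsto (Inv.inv : ℂ → ℂ) (cocompact ℂ) (𝓝 0) := by
              rw [← Metric.cobounded_eq_cocompact]
              exact tendsto_inv₀_cobounded
            exact h0.comp this
          simpa using (h2.const_mul (c - b)).const_add 1
        have h2 := hwt.mul h1
        rw [mul_one] at h2
        refine h2.congr' ?_
        have : ∀ᶠ u in cocompact ℂ, u ≠ c := by
          have := (isCompact_singleton (x := c)).compl_mem_cocompact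
          filter_upwards [this] with u hu using hu
        filter_upwards [this] with u hu
        have huc : u - c ≠ 0 := sub_ne_zero.mpr hu
        simp only [ht]
        field_simp
        ring
      have hlim : Tendsto (fun τ => (t (ray τ)).re) atTop (𝓝 1) := by
        have := (Complex.continuous_re.tendsto (1:ℂ)).comp (htl.comp hrt)
        simpa [Function.comp_def] using this
      obtain ⟨τ, hτ1, hτ⟩ := ((hlim.eventually (lt_mem_nhds (show (0:ℝ) < 1 by norm_num))).and
        (eventually_ge_atTop 1)).exists
      by_contra hneg
      push Not at hneg
      have hray1 : ray 1 = z := by simp [hray]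
      have hiv := intermediate_value_Icc (f := fun τ => (t (ray τ)).re) hτ
        (hcont.mono Set.Icc_subset_Ici_self)
      obtain ⟨τ', hτ', h0⟩ := hiv (show (0:ℝ) ∈ _ from ⟨by simpa [hray1] using hneg, hτ1.le⟩)
      exact htre _ (hrn τ' hτ'.1) h0
    -- final computation
    have hZ : z - c ≠ 0 := norm_pos_iff.mp hzc
    have hn1 : 1 ≤ ‖1 + t z‖ := by
      have := Complex.re_le_norm (1 + t z)
      simp only [Complex.add_re, Complex.one_re] at this
      linarith
    have h1t : 1 + t z ≠ 0 := by rw [← norm_pos_iff]; linarith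
    have hws : w z * (z - b) = t z * (z - c) := by
      simp only [ht]; field_simp
    have e2 := ht2 z hz10
    have key : 2 / d ^ 2 * (z + -c + -1 * (w z * (z + -b))) - (z - c)⁻¹
        = d ^ 2 / (z - c) ^ 3 / (1 + t z) ^ 2 := by
      simp only [← sub_eq_add_neg]
      rw [hws]
      have e3 : (1 - t z) * (1 + t z) * (z - c) ^ 2 = d ^ 2 := by
        field_simp at e2
        linear_combination -e2
      rw [eq_div_iff (pow_ne_zero _ h1t), eq_div_iff (pow_ne_zero _ hZ)]
      have e4 : 2 / d ^ 2 * (z - c + -1 * (t z * (z - c))) * (1 + t z) * (z - c) = 2 := by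
        have : 2 / d ^ 2 * (z - c + -1 * (t z * (z - c))) * (1 + t z) * (z - c)
          = 2 / d ^ 2 * ((1 - t z) * (1 + t z) * (z - c) ^ 2) := by ring
        rw [this, e3]
        field_simp
      have e5 : (z - c)⁻¹ * (z - c) = 1 := inv_mul_cancel₀ hZ
      linear_combination (1 + t z) * (z - c) ^ 2 * e4 - (1 + t z) ^ 2 * (z - c) ^ 2 * e5 + e3
    simp only
    rw [key, norm_div, norm_div, norm_pow, norm_pow, norm_pow, hd]
    have h5 : 1 ≤ ‖1 + t z‖ ^ 2 := one_le_pow₀ hn1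
    rw [div_div, div_le_div_iff₀ (by positivity) (by positivity)]
    have : 0 < ‖z - c‖ ^ 3 := by positivity
    nlinarith

/-- The final kernel estimate. -/
lemma kernel_est {z ζ c hz : ℂ} (hζ : ‖ζ - c‖ ≤ 5)
    (h1 : ‖z - c‖ ≤ 10 → ‖hz‖ ≤ 168) (h2 : 10 ≤ ‖z - c‖ → ‖hz - (z - c)⁻¹‖ ≤ 1 / ‖z - c‖ ^ 3) :
    ‖hz + (ζ - c) * hz ^ 2 - (z - ζ)⁻¹‖ ≤
      if ‖z - ζ‖ ≤ 15 then 150000 + ‖z - ζ‖⁻¹ else 400 * ‖z - ζ‖⁻¹ ^ 3 := by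
  have htri := norm_sub_le_norm_sub_add_norm_sub z c ζ
  rw [norm_sub_rev c ζ] at htri
  rcases le_or_gt ‖z - c‖ 10 with hle | hgt
  · have h := h1 hle
    rw [if_pos (by linarith)]
    refine (norm_sub_le _ _).trans ?_
    rw [norm_inv]
    gcongr
    refine (norm_add_le _ _).trans ?_
    rw [norm_mul, norm_pow]
    have : ‖ζ - c‖ * ‖hz‖ ^ 2 ≤ 5 * 168 ^ 2 := by gcongr
    linarith
  · have h := h2 hgt.le
    set Z := z - c with hZ
    set η := ζ - c with hη
    have hzζ : z - ζ = Z - η := by rw [hZ, hη]; ring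
    have hZp : 0 < ‖Z‖ := by linarith
    have hZ0 : Z ≠ 0 := norm_pos_iff.mp hZp
    have hlow : ‖Z‖ / 2 ≤ ‖Z - η‖ := by
      have := norm_sub_norm_le Z η
      linarith
    have hZη : Z - η ≠ 0 := by rw [← norm_pos_iff]; linarith
    rw [hzζ] at htri ⊢
    have e : hz + η * hz ^ 2 - (Z - η)⁻¹ =
        (hz - Z⁻¹) * (1 + η * (hz - Z⁻¹) + 2 * η * Z⁻¹) - η ^ 2 / (Z ^ 2 * (Z - η)) := by
      field_simp
      ring
    have b1 : ‖hz - Z⁻¹‖ ≤ 1 / 1000 := by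
      refine h.trans ?_
      apply one_div_le_one_div_of_le (by norm_num)
      have : (10:ℝ) ^ 3 ≤ ‖Z‖ ^ 3 := by gcongr
      linarith
    have b2 : ‖1 + η * (hz - Z⁻¹) + 2 * η * Z⁻¹‖ ≤ 3 := by
      refine (norm_add_le _ _).trans ?_
      have c1 : ‖(1:ℂ) + η * (hz - Z⁻¹)‖ ≤ 1 + 5 * (1/1000) := by
        refine (norm_add_le _ _).trans ?_
        rw [norm_mul, norm_one]; gcongr
      have c2 : ‖2 * η * Z⁻¹‖ ≤ 2 * 5 * 10⁻¹ := by
        rw [norm_mul, norm_mul, norm_inv, Complex.norm_ofNat]; gcongr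
      norm_num at c1 c2 ⊢
      linarith
    have b3 : ‖η ^ 2 / (Z ^ 2 * (Z - η))‖ ≤ 50 / ‖Z‖ ^ 3 := by
      rw [norm_div, norm_mul, norm_pow, norm_pow, div_le_div_iff₀ (by positivity) (by positivity)]
      have : ‖η‖ ^ 2 ≤ 25 := by nlinarith [norm_nonneg η]
      have h3 : ‖Z‖ ^ 2 * (‖Z‖ / 2) ≤ ‖Z‖ ^ 2 * ‖Z - η‖ := by gcongr
      have h4 : ‖η‖ ^ 2 * ‖Z‖ ^ 3 ≤ 25 * ‖Z‖ ^ 3 := by gcongr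
      nlinarith
    have tot : ‖hz + η * hz ^ 2 - (Z - η)⁻¹‖ ≤ 53 / ‖Z‖ ^ 3 := by
      rw [e]
      refine (norm_sub_le _ _).trans ?_
      rw [norm_mul]
      have : ‖hz - Z⁻¹‖ * ‖1 + η * (hz - Z⁻¹) + 2 * η * Z⁻¹‖ ≤ 1 / ‖Z‖ ^ 3 * 3 := by gcongr
      have e' : 53 / ‖Z‖ ^ 3 = 1 / ‖Z‖ ^ 3 * 3 + 50 / ‖Z‖ ^ 3 := by ring
      linarith
    have hZη' : 0 < ‖Z - η‖ := by linarith
    split_ifs with hif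
    · refine tot.trans ?_
      have : 53 / ‖Z‖ ^ 3 ≤ 53 / 10 ^ 3 := by gcongr
      have h0 : 0 < ‖Z - η‖⁻¹ := by positivity
      norm_num at this
      linarith
    · refine tot.trans ?_
      have hup : ‖Z - η‖ ≤ 3 / 2 * ‖Z‖ := by linarith
      rw [inv_pow, ← div_eq_mul_inv, div_le_div_iff₀ (by positivity) (by positivity)]
      have : ‖Z - η‖ ^ 3 ≤ (3 / 2 * ‖Z‖) ^ 3 := by gcongr
      have : 0 < ‖Z‖ ^ 3 := by positivity
      nlinarith

noncomputable def kap (t : ℝ) : ℝ := if t ≤ 15 then 150000 + t⁻¹ else 400 * t⁻¹ ^ 3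

lemma kap_nonneg {t : ℝ} (ht : 0 ≤ t) : 0 ≤ kap t := by
  unfold kap; split_ifs <;> positivity

lemma kap_int : Integrable (fun ζ : ℂ => kap ‖ζ‖) := by
  rw [integrable_fun_norm_addHaar (volume : Measure ℂ) (f := kap)]
  rw [Complex.finrank_real_complex]
  rw [← Set.Ioc_union_Ioi_eq_Ioi (show (0:ℝ) ≤ 15 by norm_num)]
  apply IntegrableOn.union
  · have : IntegrableOn (fun y : ℝ => 150000 * y + 1) (Set.Ioc 0 15) :=
      (Continuous.integrableOn_Icc (by fun_prop)).mono_set Set.Ioc_subset_Icc_self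
    refine this.congr_fun (fun y hy => ?_) measurableSet_Ioc
    have hy0 : y ≠ 0 := hy.1.ne'
    simp only [kap, if_pos hy.2, smul_eq_mul]
    field_simp
    ring
  · have := (integrableOn_Ioi_rpow_of_lt (show (-2:ℝ) < -1 by norm_num)
      (show (0:ℝ) < 15 by norm_num)).const_mul 400
    refine IntegrableOn.congr_fun this (fun y hy => ?_) measurableSet_Ioi
    have hy' : (15:ℝ) < y := hy
    have hy0 : 0 < y := by linarith
    simp only [kap, if_neg (not_le.mpr hy'), smul_eq_mul]
    rw [Real.rpow_neg hy0.le]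
    norm_cast
    field_simp
    norm_num

/-- The Wirtinger derivative. -/
noncomputable def dbar (Φ : ℂ → ℂ) (z : ℂ) : ℂ :=
  (1 / 2 : ℂ) * (fderiv ℝ Φ z 1 + Complex.I * fderiv ℝ Φ z Complex.I)

lemma dbar_cont {Φ : ℂ → ℂ} (hΦ : ContDiff ℝ 1 Φ) : Continuous (dbar Φ) := by
  have h := hΦ.continuous_fderiv (by norm_num)
  unfold dbar
  fun_prop

lemma dbar_cs {Φ : ℂ → ℂ} (hΦ : HasCompactSupport Φ) : HasCompactSupport (dbar Φ) := by
  have h := hΦ.fderiv (𝕜 := ℝ)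
  refine h.mono ?_
  intro z hz
  contrapose! hz
  simp only [Function.mem_support, not_not] at hz
  simp [dbar, hz]

lemma dbar_eq_zero {Φ : ℂ → ℂ} {z : ℂ} (h : DifferentiableAt ℂ Φ z) : dbar Φ z = 0 := by
  have := h.hasFDerivAt.restrictScalars ℝ
  unfold dbar
  rw [this.fderiv]
  have e : (fderiv ℂ Φ z) Complex.I = Complex.I * (fderiv ℂ Φ z) 1 := by
    have := (fderiv ℂ Φ z).map_smul Complex.I 1
    rwa [smul_eq_mul, mul_one, smul_eq_mul] at this
  simp only [ContinuousLinearMap.coe_restrictScalars']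
  rw [e, ← mul_assoc, Complex.I_mul_I]
  ring

lemma cauchy_pompeiu {Φ : ℂ → ℂ} (hΦ : ContDiff ℝ 1 Φ) (hcs : HasCompactSupport Φ) (z : ℂ) :
    ∫ ζ, dbar Φ ζ * (z - ζ)⁻¹ = Real.pi * Φ z := by
  have h0 : ∫ ζ, dbar Φ ζ * (z - ζ)⁻¹ = ∫ ξ, dbar Φ (z + ξ) * (-ξ)⁻¹ := by
    rw [← integral_add_left_eq_self (fun ζ => dbar Φ ζ * (z - ζ)⁻¹) z]
    simp
  rw [h0, ← Complex.integral_comp_polarCoord_symm]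
  obtain ⟨R, hR, hRs⟩ : ∃ R > 0, ∀ ζ ∈ tsupport Φ, ‖ζ - z‖ < R := by
    obtain ⟨R, hR⟩ := (Metric.isBounded_iff_subset_ball z).mp (IsCompact.isBounded hcs)
    refine ⟨max R 1, by positivity, fun ζ hζ => ?_⟩
    have := hR hζ
    rw [mem_ball, dist_eq_norm] at this
    exact this.trans_le (le_max_left _ _)
  set e : ℝ → ℂ := fun θ => Complex.exp (θ * Complex.I) with he
  have hen : ∀ θ, ‖e θ‖ = 1 := fun θ => Complex.norm_exp_ofReal_mul_I θ
  have hec : Continuous e := by fun_prop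
  have hD := hΦ.continuous_fderiv (by norm_num)
  set A : ℝ × ℝ → ℂ := fun p => fderiv ℝ Φ (z + p.1 * e p.2) (e p.2) with hA
  set B : ℝ × ℝ → ℂ := fun p => fderiv ℝ Φ (z + p.1 * e p.2) (Complex.I * e p.2) with hB
  have hAc : Continuous A := by
    simp only [hA]
    fun_prop
  have hBc : Continuous B := by
    simp only [hB]
    fun_prop
  have hnorm : ∀ p : ℝ × ℝ, 0 ≤ p.1 → ‖(z + p.1 * e p.2) - z‖ = p.1 := by
    intro p hp
    rw [add_sub_cancel_left, norm_mul, hen, Complex.norm_real, Real.norm_of_nonneg hp, mul_one]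
  have hfd0 : ∀ p : ℝ × ℝ, R ≤ p.1 → fderiv ℝ Φ (z + p.1 * e p.2) = 0 := by
    intro p hp
    by_contra hne
    have h1 := support_fderiv_subset ℝ (Function.mem_support.mpr hne)
    have := hRs _ h1
    rw [hnorm p (hR.le.trans hp)] at this
    linarith
  have hpt : ∀ p ∈ polarCoord.target, p.1 • (dbar Φ (z + Complex.polarCoord.symm p) *
      (-(Complex.polarCoord.symm p))⁻¹) = -(1/2) * (A p + Complex.I * B p) := by
    intro p hp
    have hp1 : 0 < p.1 := by
      have := hp
      simp only [polarCoord_target, Set.mem_prod, Set.mem_Ioi] at this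
      exact this.1
    have hsym : Complex.polarCoord.symm p = p.1 * e p.2 := by
      rw [Complex.polarCoord_symm_apply, he]
      simp only
      rw [Complex.exp_mul_I]
      push_cast
      rfl
    rw [hsym]
    set W := z + p.1 * e p.2
    have hlin : ∀ v : ℂ, fderiv ℝ Φ W v = v.re * fderiv ℝ Φ W 1 + v.im * fderiv ℝ Φ W Complex.I := by
      intro v
      conv_lhs => rw [← Complex.re_add_im v]
      rw [map_add]
      have h1 : ((v.re : ℝ) : ℂ) = v.re • (1:ℂ) := by simp
      have h2 : ((v.im : ℝ) : ℂ) * Complex.I = v.im • Complex.I := by simp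
      rw [h1, h2, map_smul, map_smul]
      simp
    have hAp : A p = fderiv ℝ Φ W (e p.2) := rfl
    have hBp : B p = fderiv ℝ Φ W (Complex.I * e p.2) := rfl
    have hre : (e p.2).re = Real.cos p.2 := by rw [he]; exact Complex.exp_ofReal_mul_I_re _
    have him : (e p.2).im = Real.sin p.2 := by rw [he]; exact Complex.exp_ofReal_mul_I_im _
    have hexp : e p.2 = Real.cos p.2 + Real.sin p.2 * Complex.I := by
      rw [← Complex.re_add_im (e p.2), hre, him]
    rw [hAp, hBp, hlin (e p.2), hlin (Complex.I * e p.2)]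
    simp only [Complex.mul_re, Complex.mul_im, Complex.I_re, Complex.I_im, zero_mul, one_mul,
      zero_sub, zero_add, hre, him]
    have hne : e p.2 ≠ 0 := Complex.exp_ne_zero _
    have hpne : (p.1 : ℂ) ≠ 0 := by exact_mod_cast hp1.ne'
    rw [Complex.real_smul]
    have e1 : (p.1 : ℂ) * (dbar Φ W * (-((p.1:ℂ) * e p.2))⁻¹) = - dbar Φ W * (e p.2)⁻¹ := by
      field_simp
    have e2 : (e p.2)⁻¹ = Real.cos p.2 - Real.sin p.2 * Complex.I := by
      apply inv_eq_of_mul_eq_one_left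
      rw [hexp]
      have := Complex.sin_sq_add_cos_sq (p.2 : ℂ)
      push_cast
      linear_combination this - Complex.sin p.2 ^ 2 * Complex.I_sq
    rw [e1, e2]
    unfold dbar
    push_cast
    linear_combination (1/2 * Complex.sin p.2 * fderiv ℝ Φ W Complex.I) * Complex.I_sq
  rw [setIntegral_congr_fun polarCoord.open_target.measurableSet hpt, polarCoord_target]
  have hsub : Set.Ioc 0 R ×ˢ Set.Ioo (-Real.pi) Real.pi ⊆ Set.Ioi (0:ℝ) ×ˢ Set.Ioo (-Real.pi) Real.pi :=
    Set.prod_mono Set.Ioc_subset_Ioi_self le_rfl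
  rw [setIntegral_eq_of_subset_of_forall_sdiff_eq_zero
    (measurableSet_Ioi.prod measurableSet_Ioo) hsub]
  swap
  · rintro p ⟨⟨hp1, hp2⟩, hp3⟩
    have : R ≤ p.1 := by
      by_contra hlt
      push Not at hlt
      exact hp3 ⟨⟨hp1, hlt.le⟩, hp2⟩
    simp [hA, hB, hfd0 p this]
  have hintg : ∀ f : ℝ × ℝ → ℂ, Continuous f →
      IntegrableOn f (Set.Ioc 0 R ×ˢ Set.Ioo (-Real.pi) Real.pi) := by
    intro f hf
    have : IntegrableOn f (Set.Icc 0 R ×ˢ Set.Icc (-Real.pi) Real.pi) :=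
      hf.continuousOn.integrableOn_compact (isCompact_Icc.prod isCompact_Icc)
    exact this.mono_set (Set.prod_mono Set.Ioc_subset_Icc_self Set.Ioo_subset_Icc_self)
  have hderA : ∀ θ r : ℝ, HasDerivAt (fun r : ℝ => Φ (z + r * e θ)) (A (r, θ)) r := by
    intro θ r
    have h1 : HasFDerivAt Φ (fderiv ℝ Φ (z + r * e θ)) (z + r * e θ) :=
      (hΦ.differentiable (by norm_num) _).hasFDerivAt
    have h2 : HasDerivAt (fun r : ℝ => z + r * e θ) (e θ) r := by
      have := ((Complex.ofRealCLM.hasDerivAt (x := r)).mul_const (e θ)).const_add z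
      simpa using this
    exact h1.comp_hasDerivAt r h2
  have hderB : ∀ r θ : ℝ, HasDerivAt (fun θ : ℝ => Φ (z + r * e θ)) (r * B (r, θ)) θ := by
    intro r θ
    have h1 : HasFDerivAt Φ (fderiv ℝ Φ (z + r * e θ)) (z + r * e θ) :=
      (hΦ.differentiable (by norm_num) _).hasFDerivAt
    have h2 : HasDerivAt (fun θ : ℝ => z + r * e θ) ((r:ℂ) * (Complex.I * e θ)) θ := by
      have h3 : HasDerivAt (fun θ : ℝ => (θ : ℂ) * Complex.I) Complex.I θ := by
        have := (Complex.ofRealCLM.hasDerivAt (x := θ)).mul_const Complex.I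
        simpa using this
      have h4 := ((h3.cexp).const_mul (r:ℂ)).const_add z
      refine h4.congr_deriv ?_
      simp only [he]; ring
    have h5 := h1.comp_hasDerivAt θ h2
    refine h5.congr_deriv ?_
    have : (r:ℂ) * (Complex.I * e θ) = r • (Complex.I * e θ) := by simp
    rw [this, map_smul]
    simp [hB]
  have hIA : ∫ p in Set.Ioc 0 R ×ˢ Set.Ioo (-Real.pi) Real.pi, A p = -(2 * Real.pi) * Φ z := by
    have h1 := hintg A hAc
    have hsw : ∫ p in Set.Ioc 0 R ×ˢ Set.Ioo (-Real.pi) Real.pi, A p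
        = ∫ θ in Set.Ioo (-Real.pi) Real.pi, ∫ r in Set.Ioc 0 R, A (r, θ) := by
      rw [Measure.volume_eq_prod, setIntegral_prod _ h1]
      rw [integral_integral_swap]
      rw [IntegrableOn, Measure.volume_eq_prod, ← Measure.prod_restrict] at h1
      exact h1
    rw [hsw]
    have : ∀ θ, ∫ r in Set.Ioc 0 R, A (r, θ) = - Φ z := by
      intro θ
      rw [← intervalIntegral.integral_of_le hR.le,
        intervalIntegral.integral_eq_sub_of_hasDerivAt (f := fun r : ℝ => Φ (z + r * e θ))
          (fun r _ => hderA θ r)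
          ((by fun_prop : Continuous fun r : ℝ => A (r, θ)).intervalIntegrable _ _)]
      have hz0 : Φ (z + R * e θ) = 0 := by
        by_contra hne
        have := hRs _ (subset_tsupport _ (Function.mem_support.mpr hne))
        rw [hnorm (R, θ) hR.le] at this
        exact lt_irrefl _ this
      simp [hz0]
    simp only [this]
    rw [setIntegral_const, measureReal_def, Real.volume_Ioo, Complex.real_smul]
    rw [ENNReal.toReal_ofReal (by linarith [Real.pi_pos])]
    push_cast; ring
  have hIB : ∫ p in Set.Ioc 0 R ×ˢ Set.Ioo (-Real.pi) Real.pi, B p = 0 := by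
    have h1 := hintg B hBc
    rw [Measure.volume_eq_prod, setIntegral_prod _ h1]
    rw [setIntegral_congr_fun (g := fun _ => (0:ℂ)) measurableSet_Ioc, integral_zero]
    intro r hr
    have hr0 : (r:ℂ) ≠ 0 := by exact_mod_cast hr.1.ne'
    have h2 : ∫ θ in Set.Ioo (-Real.pi) Real.pi, (r:ℂ) * B (r, θ) = 0 := by
      rw [← integral_Ioc_eq_integral_Ioo,
        ← intervalIntegral.integral_of_le (by linarith [Real.pi_pos]),
        intervalIntegral.integral_eq_sub_of_hasDerivAt (f := fun θ : ℝ => Φ (z + r * e θ))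
          (fun θ _ => hderB r θ)
          ((by fun_prop : Continuous fun θ : ℝ => (r:ℂ) * B (r, θ)).intervalIntegrable _ _)]
      simp only [he]
      have : Complex.exp ((-Real.pi : ℝ) * Complex.I) = Complex.exp ((Real.pi : ℝ) * Complex.I) := by
        push_cast
        rw [neg_mul, Complex.exp_neg, Complex.exp_pi_mul_I]; norm_num
      rw [this, sub_self]
    rw [integral_const_mul] at h2
    simpa [hr0] using h2
  rw [integral_const_mul, integral_add (hintg A hAc) ((hintg B hBc).const_mul _), integral_const_mul,
    hIA, hIB]
  ring

/-- The bump function used for smoothing. -/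
noncomputable def bmp : ContDiffBump (0 : ℂ) := ⟨1/2, 1, by norm_num, by norm_num⟩

/-- The normalised bump. -/
noncomputable def nb : ℂ → ℝ := bmp.normed volume

/-- Smoothing of `f` at unit scale. -/
noncomputable def smo (f : ℂ → ℂ) : ℂ → ℂ :=
  convolution nb f (ContinuousLinearMap.lsmul ℝ ℝ) volume

lemma nb_cd : ContDiff ℝ 1 nb := bmp.contDiff_normed
lemma nb_cs : HasCompactSupport nb := bmp.hasCompactSupport_normed

lemma nb_ts : tsupport nb = closedBall 0 1 := bmp.tsupport_normed_eq

lemma nb_zero {t : ℂ} (ht : 1 < ‖t‖) : nb t = 0 := by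
  by_contra h
  have := subset_tsupport nb (Function.mem_support.mpr h)
  rw [nb_ts, mem_closedBall_zero_iff] at this
  linarith

lemma nb_cont : Continuous nb := nb_cd.continuous

lemma nb_nonneg (t : ℂ) : 0 ≤ nb t := bmp.nonneg_normed t

lemma nb_int : Integrable nb := nb_cont.integrable_of_hasCompactSupport nb_cs

lemma smo_apply (f : ℂ → ℂ) (x : ℂ) : smo f x = ∫ t, nb t • f (x - t) := rfl

lemma smo_integrand {f : ℂ → ℂ} (hf : Continuous f) (x : ℂ) :
    Integrable (fun t => nb t • f (x - t)) := by
  apply Continuous.integrable_of_hasCompactSupport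
  · have := nb_cont
    fun_prop
  · exact nb_cs.smul_right

lemma smo_sub (f : ℂ → ℂ) (hf : Continuous f) (c x : ℂ) :
    smo f x = smo (fun y => f y - c) x + c := by
  rw [smo_apply, smo_apply]
  have h1 : ∫ t, nb t • c = c := by
    rw [integral_smul_const]
    have : ∫ t, nb t = 1 := bmp.integral_normed
    rw [this, one_smul]
  have h2 : (fun t => nb t • (f (x - t) - c)) = fun t => nb t • f (x - t) - nb t • c := by
    ext t; rw [smul_sub]
  rw [h2, integral_sub (smo_integrand hf x) (smo_integrand (f := fun _ => c) continuous_const x),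
    h1]
  ring

lemma smo_cd {f : ℂ → ℂ} (hf : Continuous f) : ContDiff ℝ 1 (smo f) :=
  nb_cs.contDiff_convolution_left _ nb_cd hf.locallyIntegrable

lemma smo_cs {f : ℂ → ℂ} (hf : HasCompactSupport f) : HasCompactSupport (smo f) :=
  nb_cs.convolution _ hf

lemma smo_close {f : ℂ → ℂ} (hf : Continuous f) {ω : ℝ} (h : ∀ x y, ‖x - y‖ ≤ 1 → ‖f x - f y‖ ≤ ω)
    (x : ℂ) : ‖f x - smo f x‖ ≤ ω := by
  rw [← dist_eq_norm, dist_comm]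
  refine bmp.dist_normed_convolution_le hf.aestronglyMeasurable (fun y hy => ?_)
  rw [dist_eq_norm]
  apply h
  rw [← dist_eq_norm]
  exact (mem_ball.mp hy).le

/-- Gradient mass of the bump. -/
noncomputable def CA : ℝ := ∫ t, ‖fderiv ℝ nb t‖

lemma CA_nonneg : 0 ≤ CA := integral_nonneg fun _ => norm_nonneg _

lemma smo_dbar {f : ℂ → ℂ} (hf : Continuous f) {ω : ℝ} (h : ∀ x y, ‖x - y‖ ≤ 1 → ‖f x - f y‖ ≤ ω)
    (x : ℂ) : ‖dbar (smo f) x‖ ≤ CA * ω := by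
  have hω : 0 ≤ ω := (norm_nonneg _).trans (h 0 0 (by simp))
  set g : ℂ → ℂ := fun y => f y - f x with hg
  have hgc : Continuous g := by fun_prop
  have e : smo f = fun y => smo g y + f x := by
    ext y; exact smo_sub f hf (f x) y
  have hd := nb_cs.hasFDerivAt_convolution_left (ContinuousLinearMap.lsmul ℝ ℝ) nb_cd
    (hgc.locallyIntegrable (μ := volume)) x
  have hd2 := hd.add_const (f x)
  change HasFDerivAt (fun y => smo g y + f x) _ x at hd2
  rw [← e] at hd2
  have hnorm : ‖fderiv ℝ (smo f) x‖ ≤ CA * ω := by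
    rw [hd2.fderiv, convolution_def, CA, ← integral_mul_const]
    apply norm_integral_le_of_norm_le
    · apply Integrable.mul_const
      apply Integrable.norm
      exact (nb_cd.continuous_fderiv (by norm_num)).integrable_of_hasCompactSupport
        (nb_cs.fderiv (𝕜 := ℝ))
    · refine Eventually.of_forall fun t => ?_
      by_cases ht : fderiv ℝ nb t = 0
      · rw [ht]; simp
      · have h1 := support_fderiv_subset ℝ (Function.mem_support.mpr ht)
        rw [nb_ts, mem_closedBall_zero_iff] at h1
        have h2 : ‖g (x - t)‖ ≤ ω := h _ _ (by simpa using h1)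
        have h3 : ‖((ContinuousLinearMap.lsmul ℝ ℝ).precompL ℂ) (fderiv ℝ nb t) (g (x - t))‖
            ≤ ‖fderiv ℝ nb t‖ * ‖g (x - t)‖ := by
          apply ContinuousLinearMap.opNorm_le_bound _ (by positivity)
          intro v
          rw [ContinuousLinearMap.precompL_apply]
          simp only [ContinuousLinearMap.lsmul_apply, norm_smul]
          have := (fderiv ℝ nb t).le_opNorm v
          nlinarith [norm_nonneg (g (x - t))]
        exact h3.trans (by gcongr)
  unfold dbar
  have h1 := (fderiv ℝ (smo f) x).le_opNorm 1
  have h2 := (fderiv ℝ (smo f) x).le_opNorm Complex.I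
  rw [norm_one, mul_one] at h1
  rw [Complex.norm_I, mul_one] at h2
  rw [norm_mul]
  have h3 : ‖fderiv ℝ (smo f) x 1 + Complex.I * fderiv ℝ (smo f) x Complex.I‖ ≤ 2 * (CA * ω) := by
    refine (norm_add_le _ _).trans ?_
    rw [norm_mul, Complex.norm_I, one_mul]
    linarith
  have h4 : ‖(1/2 : ℂ)‖ = 1/2 := by norm_num
  rw [h4]
  linarith

lemma smo_holo {f : ℂ → ℂ} (hf : Continuous f) {K : Set ℂ} (hK : DifferentiableOn ℂ f (interior K))
    {x : ℂ} (hx : ball x 2 ⊆ K) : dbar (smo f) x = 0 := by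
  apply dbar_eq_zero
  have hU : DifferentiableOn ℂ f (ball x 2) := hK.mono (interior_maximal hx isOpen_ball)
  have hdc : ContinuousOn (deriv f) (closedBall x (3/2)) :=
    ((hU.deriv isOpen_ball).continuousOn).mono (closedBall_subset_ball (by norm_num))
  obtain ⟨M, hM⟩ := (isCompact_closedBall x (3/2)).exists_bound_of_continuousOn hdc
  have key := hasDerivAt_integral_of_dominated_loc_of_deriv_le (μ := (volume : Measure ℂ)) (𝕜 := ℂ)
    (F := fun y t => nb t • f (y - t)) (F' := fun y t => nb t • deriv f (y - t)) (x₀ := x)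
    (s := ball x (1/2)) (bound := fun t => nb t * M) (ball_mem_nhds x (by norm_num))
    (Eventually.of_forall fun y => (smo_integrand hf y).aestronglyMeasurable)
    (smo_integrand hf x) ?_ ?_ (nb_int.mul_const M) ?_
  · exact key.2.differentiableAt
  · apply AEStronglyMeasurable.smul nb_cont.aestronglyMeasurable
    exact ((measurable_deriv f).comp (by fun_prop : Measurable fun t => x - t)).aestronglyMeasurable
  · refine Eventually.of_forall fun t y hy => ?_
    rw [norm_smul, Real.norm_of_nonneg (nb_nonneg t)]
    by_cases ht : 1 < ‖t‖
    · simp [nb_zero ht]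
    · push Not at ht
      gcongr
      · exact nb_nonneg t
      · apply hM
        rw [mem_ball, dist_eq_norm] at hy
        rw [mem_closedBall, dist_eq_norm]
        have : y - t - x = (y - x) - t := by ring
        rw [this]
        refine (norm_sub_le _ _).trans ?_
        linarith
  · refine Eventually.of_forall fun t y hy => ?_
    by_cases ht : 1 < ‖t‖
    · simp only [nb_zero ht, zero_smul]
      exact hasDerivAt_const _ _
    · push Not at ht
      have hm : y - t ∈ ball x 2 := by
        rw [mem_ball, dist_eq_norm] at hy ⊢
        have : y - t - x = (y - x) - t := by ring
        rw [this]
        refine (norm_sub_le _ _).trans_lt ?_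
        linarith
      have h1 := (hU.differentiableAt (isOpen_ball.mem_nhds hm)).hasDerivAt
      have h2 := h1.comp_sub_const y t
      exact h2.const_smul (nb t)

lemma kap_inv {t : ℝ} (ht : 0 ≤ t) : t⁻¹ ≤ kap t + 1 := by
  unfold kap
  split_ifs with h
  · linarith
  · push Not at h
    have : t⁻¹ ≤ 1 := inv_le_one_of_one_le₀ (by linarith)
    have : 0 ≤ 400 * t⁻¹ ^ 3 := by positivity
    linarith

lemma kap_int' (z : ℂ) : Integrable (fun ζ : ℂ => kap ‖z - ζ‖) :=
  kap_int.comp_sub_left z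

lemma D_int {D : ℂ → ℂ} (hD : Continuous D) (hDc : HasCompactSupport D) {M : ℝ}
    (hM : ∀ ζ, ‖D ζ‖ ≤ M) (z : ℂ) : Integrable (fun ζ => D ζ * (z - ζ)⁻¹) := by
  have hDi := hD.integrable_of_hasCompactSupport (μ := (volume : Measure ℂ)) hDc
  refine Integrable.mono' (((kap_int' z).const_mul M).add hDi.norm) ?_ ?_
  · apply AEStronglyMeasurable.mul hD.aestronglyMeasurable
    exact (by fun_prop : Measurable fun ζ : ℂ => (z - ζ)⁻¹).aestronglyMeasurable
  · refine Eventually.of_forall fun ζ => ?_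
    rw [norm_mul, norm_inv]
    have h1 := kap_inv (norm_nonneg (z - ζ))
    have h2 := kap_nonneg (norm_nonneg (z - ζ))
    simp only [Pi.add_apply]
    calc ‖D ζ‖ * ‖z - ζ‖⁻¹ ≤ ‖D ζ‖ * (kap ‖z - ζ‖ + 1) := by gcongr
      _ = ‖D ζ‖ * kap ‖z - ζ‖ + ‖D ζ‖ := by ring
      _ ≤ _ := by gcongr; exact hM ζ

/-- The final constant. -/
noncomputable def CM : ℝ := 1 + CA * (∫ ζ : ℂ, kap ‖ζ‖) / Real.pi

lemma mergelyan_step {K : Set ℂ} (hK : IsCompact K) (hc : IsConnected Kᶜ) {f : ℂ → ℂ}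
    (hf : Continuous f) (hfc : HasCompactSupport f) (hfd : DifferentiableOn ℂ f (interior K))
    {ω : ℝ} (h : ∀ x y, ‖x - y‖ ≤ 1 → ‖f x - f y‖ ≤ ω) :
    ∃ F, PA K F ∧ ∀ z ∈ K, ‖f z - F z‖ ≤ CM * ω := by
  classical
  set Φ := smo f with hΦ
  set D := dbar Φ with hDdef
  have hD : Continuous D := dbar_cont (smo_cd hf)
  have hDc : HasCompactSupport D := dbar_cs (smo_cs hfc)
  have hDM : ∀ ζ, ‖D ζ‖ ≤ CA * ω := smo_dbar hf h
  have hω : 0 ≤ ω := (norm_nonneg _).trans (h 0 0 (by simp))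
  have hcov : ∀ ζ ∈ tsupport D, ∃ a ∉ K, ‖ζ - a‖ < 4 := by
    intro ζ hζ
    obtain ⟨ζ', h1, h2⟩ := Metric.mem_closure_iff.mp hζ 1 one_pos
    have h3 : ¬ ball ζ' 2 ⊆ K := fun hb => h1 (smo_holo hf hfd hb)
    obtain ⟨a, ha, haK⟩ := Set.not_subset.mp h3
    refine ⟨a, haK, ?_⟩
    rw [← dist_eq_norm]
    rw [mem_ball, dist_comm] at ha
    linarith [dist_triangle ζ ζ' a]
  choose hh cc hPA hcc hb1 hb2 using fun a : {a : ℂ // a ∉ K} => kernel hK hc a.2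
  obtain ⟨t, ht⟩ := IsCompact.elim_finite_subcover (hDc : IsCompact (tsupport D))
    (fun a : {a : ℂ // a ∉ K} => ball (a : ℂ) 4) (fun a => isOpen_ball) (by
      intro ζ hζ
      obtain ⟨a, ha, h4⟩ := hcov ζ hζ
      exact Set.mem_iUnion.mpr ⟨⟨a, ha⟩, by rwa [mem_ball, dist_eq_norm]⟩)
  set ind : {a : ℂ // a ∉ K} → ℂ → ℝ := fun a => (ball (a : ℂ) 4).indicator (fun _ => 1) with hind
  have hind0 : ∀ a ζ, 0 ≤ ind a ζ := fun a ζ =>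
    Set.indicator_nonneg (fun _ _ => zero_le_one) _
  have hindm : ∀ a, Measurable (ind a) := fun a => measurable_const.indicator measurableSet_ball
  set N : ℂ → ℝ := fun ζ => ∑ a ∈ t, ind a ζ with hN
  have hNm : Measurable N := Finset.measurable_fun_sum t fun a _ => hindm a
  have hN0 : ∀ ζ, 0 ≤ N ζ := fun ζ => Finset.sum_nonneg fun a _ => hind0 a ζ
  set w : {a : ℂ // a ∉ K} → ℂ → ℝ := fun a ζ => ind a ζ / N ζ with hw
  have hw0 : ∀ a ζ, 0 ≤ w a ζ := fun a ζ => div_nonneg (hind0 a ζ) (hN0 ζ)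
  have hwm : ∀ a, Measurable (w a) := fun a => (hindm a).div hNm
  have hw1 : ∀ a ∈ t, ∀ ζ, w a ζ ≤ 1 := fun a ha ζ =>
    div_le_one_of_le₀ (Finset.single_le_sum (f := fun a => ind a ζ)
      (fun a _ => hind0 a ζ) ha) (hN0 ζ)
  have hwsum : ∀ ζ, D ζ ≠ 0 → ∑ a ∈ t, w a ζ = 1 := by
    intro ζ hζ
    have h1 := ht (subset_tsupport D (Function.mem_support.mpr hζ))
    simp only [Set.mem_iUnion, exists_prop] at h1
    obtain ⟨a, ha, hb⟩ := h1
    have h2 : ind a ζ = 1 := Set.indicator_of_mem hb _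
    have h3 : 0 < N ζ := by
      have := Finset.single_le_sum (f := fun a => ind a ζ) (fun a _ => hind0 a ζ) ha
      have h4 : ind a ζ ≤ N ζ := this
      linarith
    simp only [hw]
    rw [← Finset.sum_div]
    exact div_self h3.ne'
  have hwball : ∀ a ζ, w a ζ ≠ 0 → ‖ζ - cc a‖ ≤ 5 := by
    intro a ζ hne
    have h1 : ζ ∈ ball (a : ℂ) 4 := by
      by_contra hb
      apply hne
      have : ind a ζ = 0 := Set.indicator_of_notMem hb _
      simp [hw, this]
    rw [mem_ball, dist_eq_norm] at h1
    have h2 := hcc a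
    have : ζ - cc a = (ζ - a) - (cc a - a) := by ring
    rw [this]
    refine (norm_sub_le _ _).trans ?_
    linarith
  have hwint : ∀ a ∈ t, ∀ G : ℂ → ℂ, Continuous G →
      Integrable (fun ζ => (w a ζ : ℂ) * (D ζ * G ζ)) := by
    intro a ha G hG
    have hi : Integrable (fun ζ => D ζ * G ζ) :=
      (hD.mul hG).integrable_of_hasCompactSupport hDc.mul_right
    refine Integrable.mono' hi.norm ?_ ?_
    · exact (Complex.measurable_ofReal.comp (hwm a)).aestronglyMeasurable.mul
        (hD.mul hG).aestronglyMeasurable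
    · refine Eventually.of_forall fun ζ => ?_
      rw [norm_mul (w a ζ : ℂ), Complex.norm_real, Real.norm_of_nonneg (hw0 a ζ)]
      exact mul_le_of_le_one_left (norm_nonneg _) (hw1 a ha ζ)
  set al : {a : ℂ // a ∉ K} → ℂ := fun a => ∫ ζ, (w a ζ : ℂ) * (D ζ * 1)
  set be : {a : ℂ // a ∉ K} → ℂ := fun a => ∫ ζ, (w a ζ : ℂ) * (D ζ * (ζ - cc a))
  refine ⟨fun z => (Real.pi : ℂ)⁻¹ * ∑ a ∈ t, (al a * hh a z + be a * hh a z ^ 2), ?_, ?_⟩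
  · apply PA.cmul hK
    apply PA.sum
    intro a _
    exact ((hPA a).cmul hK _).add (((hPA a).pow hK 2).cmul hK _)
  · intro z hz
    have hpi : (Real.pi : ℂ) ≠ 0 := by exact_mod_cast Real.pi_ne_zero
    have e1 : ∑ a ∈ t, (al a * hh a z + be a * hh a z ^ 2)
        = ∫ ζ, ∑ a ∈ t, ((w a ζ : ℂ) * (D ζ * 1) * hh a z
            + (w a ζ : ℂ) * (D ζ * (ζ - cc a)) * hh a z ^ 2) := by
      rw [integral_finsetSum]
      · refine Finset.sum_congr rfl fun a ha => ?_
        rw [integral_add, integral_mul_const, integral_mul_const]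
        · exact (hwint a ha _ continuous_const).mul_const _
        · exact (hwint a ha _ (by fun_prop)).mul_const _
      · intro a ha
        exact ((hwint a ha _ continuous_const).mul_const _).add
          ((hwint a ha _ (by fun_prop)).mul_const _)
    have hI : Integrable (fun ζ => ∑ a ∈ t, ((w a ζ : ℂ) * (D ζ * 1) * hh a z
            + (w a ζ : ℂ) * (D ζ * (ζ - cc a)) * hh a z ^ 2)) := by
      apply integrable_finsetSum
      intro a ha
      exact ((hwint a ha _ continuous_const).mul_const _).add
          ((hwint a ha _ (by fun_prop)).mul_const _)
    have e2 : (Real.pi : ℂ) * Φ z - ∑ a ∈ t, (al a * hh a z + be a * hh a z ^ 2)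
        = ∫ ζ, (D ζ * (z - ζ)⁻¹ - ∑ a ∈ t, ((w a ζ : ℂ) * (D ζ * 1) * hh a z
            + (w a ζ : ℂ) * (D ζ * (ζ - cc a)) * hh a z ^ 2)) := by
      rw [integral_sub (D_int hD hDc hDM z) hI, ← e1, cauchy_pompeiu (smo_cd hf) (smo_cs hfc)]
    have e3 : ‖(Real.pi : ℂ) * Φ z - ∑ a ∈ t, (al a * hh a z + be a * hh a z ^ 2)‖
        ≤ CA * ω * ∫ ζ : ℂ, kap ‖ζ‖ := by
      rw [e2, ← integral_sub_left_eq_self (fun ζ : ℂ => kap ‖ζ‖) volume z, ← integral_const_mul]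
      refine norm_integral_le_of_norm_le ((kap_int' z).const_mul _) ?_
      refine Eventually.of_forall fun ζ => ?_
      have hk0 := kap_nonneg (norm_nonneg (z - ζ))
      by_cases h0 : D ζ = 0
      · simp only [h0, zero_mul, mul_zero, add_zero, Finset.sum_const_zero, sub_zero, norm_zero]
        exact mul_nonneg (mul_nonneg CA_nonneg hω) hk0
      · have hs := hwsum ζ h0
        have hs' : ∑ a ∈ t, (w a ζ : ℂ) = 1 := by exact_mod_cast hs
        have e4 : D ζ * (z - ζ)⁻¹ - ∑ a ∈ t, ((w a ζ : ℂ) * (D ζ * 1) * hh a z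
            + (w a ζ : ℂ) * (D ζ * (ζ - cc a)) * hh a z ^ 2)
            = D ζ * -∑ a ∈ t, (w a ζ : ℂ) * (hh a z + (ζ - cc a) * hh a z ^ 2 - (z - ζ)⁻¹) := by
          simp only [mul_sub, Finset.sum_sub_distrib]
          rw [← Finset.sum_mul, hs', mul_neg, mul_sub, Finset.mul_sum]
          have : ∀ a, (w a ζ : ℂ) * (D ζ * 1) * hh a z
            + (w a ζ : ℂ) * (D ζ * (ζ - cc a)) * hh a z ^ 2
            = D ζ * ((w a ζ : ℂ) * (hh a z + (ζ - cc a) * hh a z ^ 2)) := fun a => by ring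
          simp only [← mul_sub, this]
          ring
        rw [e4, norm_mul, norm_neg]
        have h5 : ‖∑ a ∈ t, (w a ζ : ℂ) * (hh a z + (ζ - cc a) * hh a z ^ 2 - (z - ζ)⁻¹)‖
            ≤ kap ‖z - ζ‖ := by
          calc _ ≤ ∑ a ∈ t, w a ζ * kap ‖z - ζ‖ := by
                refine norm_sum_le_of_le _ fun a _ => ?_
                rw [norm_mul, Complex.norm_real, Real.norm_of_nonneg (hw0 a ζ)]
                by_cases hwz : w a ζ = 0
                · simp [hwz]
                · exact mul_le_mul_of_nonneg_left
                    (kernel_est (hwball a ζ hwz) (hb1 a z hz) (hb2 a z hz)) (hw0 a ζ)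
            _ = _ := by rw [← Finset.sum_mul, hs, one_mul]
        exact mul_le_mul (hDM ζ) h5 (norm_nonneg _) (mul_nonneg CA_nonneg hω)
    set Sg := ∑ a ∈ t, (al a * hh a z + be a * hh a z ^ 2)
    have e5 : f z - (Real.pi : ℂ)⁻¹ * Sg = (f z - Φ z) + (Real.pi : ℂ)⁻¹ * (Real.pi * Φ z - Sg) := by
      field_simp
      ring
    rw [e5]
    refine (norm_add_le _ _).trans ?_
    rw [norm_mul, norm_inv, Complex.norm_real, Real.norm_of_nonneg Real.pi_pos.le]
    have h6 := smo_close hf h z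
    calc ‖f z - Φ z‖ + Real.pi⁻¹ * ‖Real.pi * Φ z - Sg‖
        ≤ ω + Real.pi⁻¹ * (CA * ω * ∫ ζ : ℂ, kap ‖ζ‖) := by gcongr
      _ = CM * ω := by unfold CM; ring

lemma CM_pos : 0 < CM := by
  have h1 : 0 ≤ ∫ ζ : ℂ, kap ‖ζ‖ := integral_nonneg fun _ => kap_nonneg (norm_nonneg _)
  have h2 := CA_nonneg
  have h3 := Real.pi_pos
  unfold CM
  positivity

theorem mergelyan {K : Set ℂ} (hK : IsCompact K) (hc : IsConnected Kᶜ) {f : ℂ → ℂ}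
    (hf : ContinuousOn f K) (hfd : DifferentiableOn ℂ f (interior K)) : PA K f := by
  obtain ⟨g, hg⟩ := ContinuousMap.exists_restrict_eq hK.isClosed
    (⟨K.domRestrict f, continuousOn_iff_continuous_domRestrict.mp hf⟩ : C(K, ℂ))
  have hg' : ∀ z ∈ K, g z = f z := fun z hz => by
    have := congrArg (fun q : C(K, ℂ) => q ⟨z, hz⟩) hg
    exact this
  obtain ⟨R, hR, hKR⟩ := hK.isBounded.exists_pos_norm_le
  set ψ : ℂ → ℂ := fun z => ((max 0 (min 1 (R + 1 - ‖z‖)) : ℝ) : ℂ) with hψ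
  set G : ℂ → ℂ := fun z => ψ z * g z with hG
  have hψc : Continuous ψ := by
    simp only [hψ]; fun_prop
  have hGc : Continuous G := hψc.mul g.continuous
  have hGs : HasCompactSupport G := by
    refine HasCompactSupport.intro (isCompact_closedBall (0:ℂ) (R + 1)) fun z hz => ?_
    rw [mem_closedBall_zero_iff, not_le] at hz
    have : max 0 (min 1 (R + 1 - ‖z‖)) = 0 :=
      max_eq_left ((min_le_right _ _).trans (by linarith))
    simp only [hG, hψ, this]
    simp
  have hGK : ∀ z ∈ K, G z = f z := by
    intro z hz
    have h1 := hKR z hz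
    have : max 0 (min 1 (R + 1 - ‖z‖)) = 1 := by
      rw [min_eq_left (by linarith), max_eq_right zero_le_one]
    simp only [hG, hψ, this, hg' z hz]
    simp
  have hGd : DifferentiableOn ℂ G (interior K) :=
    hfd.congr fun z hz => hGK z (interior_subset hz)
  have huc : UniformContinuous G := by
    exact hGs.uniformContinuous_of_continuous hGc
  intro ε hε
  obtain ⟨δ, hδ, hδ'⟩ := Metric.uniformContinuous_iff.mp huc (ε / 2 / CM)
    (by have := CM_pos; positivity)
  set d : ℂ := ((δ / 2 : ℝ) : ℂ) with hd
  have hd0 : d ≠ 0 := by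
    rw [hd]; exact_mod_cast (half_pos hδ).ne'
  have hdn : ‖d‖ = δ / 2 := by
    rw [hd, Complex.norm_real, Real.norm_of_nonneg (half_pos hδ).le]
  set e := Homeomorph.mulLeft₀ d hd0 with he
  have hee : ∀ z, e z = d * z := fun z => rfl
  have hK' : IsCompact (e ⁻¹' K) := e.isCompact_preimage.mpr hK
  have hc' : IsConnected (e ⁻¹' K)ᶜ := by
    rw [← Set.preimage_compl]
    exact e.isConnected_preimage.mpr hc
  obtain ⟨F, hF, hFG⟩ := mergelyan_step (ω := ε / 2 / CM) hK' hc' (f := fun z => G (e z))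
    (hGc.comp e.continuous) (hGs.comp_homeomorph e) (by
      rw [← e.preimage_interior]
      refine DifferentiableOn.comp hGd ?_ (fun z hz => hz)
      exact ((differentiable_id.const_mul d) : Differentiable ℂ (fun z => d * z)).differentiableOn) (by
      intro x y hxy
      rw [← dist_eq_norm]
      refine (hδ' ?_).le
      rw [dist_eq_norm, hee, hee, ← mul_sub, norm_mul, hdn]
      nlinarith)
  obtain ⟨p, hp⟩ := hF (ε / 2) (half_pos hε)
  refine ⟨p.comp (Polynomial.C d⁻¹ * Polynomial.X), fun z hz => ?_⟩
  have hz' : e (d⁻¹ * z) = z := by rw [hee, mul_inv_cancel_left₀ hd0]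
  have hm : d⁻¹ * z ∈ e ⁻¹' K := by
    rw [Set.mem_preimage, hz']; exact hz
  have h1 := hFG _ hm
  have h2 := hp _ hm
  simp only [hz', hGK z hz] at h1
  rw [mul_div_cancel₀ _ CM_pos.ne'] at h1
  simp only [Polynomial.eval_comp, Polynomial.eval_mul, Polynomial.eval_C, Polynomial.eval_X]
  have : f z - p.eval (d⁻¹ * z) = (f z - F (d⁻¹ * z)) + (F (d⁻¹ * z) - p.eval (d⁻¹ * z)) := by ring
  rw [this]
  refine (norm_add_le _ _).trans ?_
  linarith

/-- Geometric polynomial approximability with rate `ρ`. -/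
def RT (L : Set ℂ) (ρ : ℝ) (f : ℂ → ℂ) : Prop :=
  ∀ σ, ρ < σ → σ < 1 → ∃ C : ℝ, 0 ≤ C ∧ ∀ n : ℕ, ∃ p : Polynomial ℂ, p.natDegree ≤ n ∧
    ∀ z ∈ L, ‖f z - p.eval z‖ ≤ C * σ ^ n

lemma RT.const {L : Set ℂ} {ρ : ℝ} (c : ℂ) : RT L ρ (fun _ => c) := by
  intro σ _ _
  exact ⟨0, le_rfl, fun n => ⟨Polynomial.C c, by simp, fun z _ => by simp⟩⟩

lemma RT.affine {L : Set ℂ} {ρ : ℝ} {f : ℂ → ℂ} (hf : RT L ρ f) (k c : ℂ) :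
    RT L ρ (fun z => k * (f z - c)) := by
  intro σ h1 h2
  obtain ⟨C, hC, h⟩ := hf σ h1 h2
  refine ⟨‖k‖ * C, by positivity, fun n => ?_⟩
  obtain ⟨p, hp, hpz⟩ := h n
  refine ⟨Polynomial.C k * (p - Polynomial.C c), ?_, fun z hz => ?_⟩
  · refine (Polynomial.natDegree_C_mul_le _ _).trans ?_
    rw [Polynomial.natDegree_sub_C]; exact hp
  · have : k * (f z - c) - Polynomial.eval z (Polynomial.C k * (p - Polynomial.C c))
        = k * (f z - p.eval z) := by simp; ring
    rw [this, norm_mul, mul_assoc]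
    gcongr
    exact hpz z hz

lemma poly_geom {τ σ : ℝ} (hτ : 0 < τ) (h : τ < σ) :
    ∃ C : ℝ, 0 ≤ C ∧ ∀ n : ℕ, (n + 1 : ℝ) * τ ^ n ≤ C * σ ^ n := by
  set δ := σ / τ - 1 with hδ
  have hδ0 : 0 < δ := by
    rw [hδ, sub_pos, lt_div_iff₀ hτ]; linarith
  refine ⟨1 + 1 / δ, by positivity, fun n => ?_⟩
  have h1 : 1 + (n:ℝ) * δ ≤ (1 + δ) ^ n := one_add_mul_le_pow (by linarith) n
  have h2 : 1 + δ = σ / τ := by rw [hδ]; ring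
  rw [h2, div_pow, le_div_iff₀ (by positivity)] at h1
  calc (n + 1 : ℝ) * τ ^ n ≤ ((1 + 1/δ) * (1 + n * δ)) * τ ^ n := by
        gcongr
        have : (1 + 1/δ) * (1 + n * δ) = 1 + n * δ + 1/δ + n := by field_simp; ring
        rw [this]
        have : 0 ≤ n * δ + 1/δ := by positivity
        linarith
    _ = (1 + 1/δ) * ((1 + n * δ) * τ ^ n) := by ring
    _ ≤ _ := by gcongr

lemma RT.mul {L : Set ℂ} (hL : IsCompact L) {ρ : ℝ} (hρ : 0 ≤ ρ) {f g : ℂ → ℂ} (hf : RT L ρ f)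
    (hg : RT L ρ g) : RT L ρ (fun z => f z * g z) := by
  intro σ h1 h2
  set τ := (ρ + σ) / 2 with hτ
  have hρτ : ρ < τ := by rw [hτ]; linarith
  have hτσ : τ < σ := by rw [hτ]; linarith
  have hτ0 : 0 < τ := by linarith
  obtain ⟨C1, hC1, hf1⟩ := hf τ hρτ (by linarith)
  obtain ⟨C2, hC2, hg1⟩ := hg τ hρτ (by linarith)
  choose P hPd hP using hf1
  choose R hRd hR using hg1
  obtain ⟨Bf, hBf, hBfz⟩ := poly_bdd hL (P 0)
  obtain ⟨Bg, hBg, hBgz⟩ := poly_bdd hL (R 0)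
  obtain ⟨C0, hC0, hgeo⟩ := poly_geom hτ0 hτσ
  have hgb : ∀ z ∈ L, ‖g z‖ ≤ C2 + Bg := by
    intro z hz
    have e : g z = (g z - (R 0).eval z) + (R 0).eval z := by ring
    rw [e]
    refine (norm_add_le _ _).trans ?_
    have := hR 0 z hz
    rw [pow_zero, mul_one] at this
    linarith [hBgz z hz]
  let Δ : ℕ → Polynomial ℂ := fun M => Nat.casesOn M (P 0) (fun k => P (k + 1) - P k)
  have hΔs : ∀ n, ∑ M ∈ Finset.range (n + 1), Δ M = P n := by
    intro n
    induction n with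
    | zero => simp [Δ]
    | succ n ih => rw [Finset.sum_range_succ, ih]; simp [Δ]
  have hΔd : ∀ M, (Δ M).natDegree ≤ M := by
    intro M
    cases M with
    | zero => exact hPd 0
    | succ k =>
      refine (Polynomial.natDegree_sub_le _ _).trans ?_
      exact max_le (hPd _) ((hPd k).trans (Nat.le_succ k))
  set C3 := Bf + C1 * (1 + τ⁻¹) with hC3
  have hC30 : 0 ≤ C3 := by positivity
  have hΔz : ∀ M, ∀ z ∈ L, ‖(Δ M).eval z‖ ≤ C3 * τ ^ M := by
    intro M z hz
    cases M with
    | zero =>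
      rw [pow_zero, mul_one]
      refine (hBfz z hz).trans ?_
      rw [hC3]
      have : 0 ≤ C1 * (1 + τ⁻¹) := by positivity
      linarith
    | succ k =>
      have e : (Δ (k + 1)).eval z = (f z - (P k).eval z) - (f z - (P (k+1)).eval z) := by
        simp [Δ]
      rw [e]
      refine (norm_sub_le _ _).trans ?_
      have a1 := hP k z hz
      have a2 := hP (k + 1) z hz
      have a3 : C1 * τ ^ k + C1 * τ ^ (k+1) = C1 * (1 + τ⁻¹) * τ ^ (k + 1) := by
        rw [pow_succ]; field_simp; ring
      have a4 : 0 ≤ Bf * τ ^ (k + 1) := by positivity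
      rw [hC3, add_mul]
      linarith
  refine ⟨(C1 * (C2 + Bg) + C3 * C2) * C0, by positivity, fun n => ?_⟩
  refine ⟨∑ M ∈ Finset.range (n + 1), Δ M * R (n - M), ?_, fun z hz => ?_⟩
  · apply Polynomial.natDegree_sum_le_of_forall_le
    intro M hM
    have hM' : M ≤ n := Nat.lt_succ_iff.mp (Finset.mem_range.mp hM)
    refine Polynomial.natDegree_mul_le.trans ?_
    have b1 := hΔd M
    have b2 := hRd (n - M)
    omega
  · have e : f z * g z - Polynomial.eval z (∑ M ∈ Finset.range (n + 1), Δ M * R (n - M))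
        = (f z - (P n).eval z) * g z
          + ∑ M ∈ Finset.range (n + 1), (Δ M).eval z * (g z - (R (n - M)).eval z) := by
      rw [← hΔs n, Polynomial.eval_finsetSum, Polynomial.eval_finsetSum]
      simp only [mul_sub, Finset.sum_sub_distrib, Polynomial.eval_mul]
      rw [← Finset.sum_mul]
      ring
    rw [e]
    have b1 : ‖(f z - (P n).eval z) * g z‖ ≤ (C1 * τ ^ n) * (C2 + Bg) := by
      rw [norm_mul]
      exact mul_le_mul (hP n z hz) (hgb z hz) (norm_nonneg _) (by positivity)
    have b2 : ‖∑ M ∈ Finset.range (n + 1), (Δ M).eval z * (g z - (R (n - M)).eval z)‖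
        ≤ ∑ M ∈ Finset.range (n + 1), C3 * C2 * τ ^ n := by
      refine norm_sum_le_of_le _ fun M hM => ?_
      have hM' : M ≤ n := Nat.lt_succ_iff.mp (Finset.mem_range.mp hM)
      rw [norm_mul]
      calc _ ≤ (C3 * τ ^ M) * (C2 * τ ^ (n - M)) :=
            mul_le_mul (hΔz M z hz) (hR _ z hz) (norm_nonneg _) (by positivity)
        _ = C3 * C2 * (τ ^ M * τ ^ (n - M)) := by ring
        _ = _ := by rw [← pow_add, Nat.add_sub_cancel' hM']
    rw [Finset.sum_const, Finset.card_range, nsmul_eq_mul] at b2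
    push_cast at b2
    refine (norm_add_le _ _).trans ((add_le_add b1 b2).trans ?_)
    have hg1 := hgeo n
    have c1 : τ ^ n ≤ (n + 1) * τ ^ n :=
      le_mul_of_one_le_left (by positivity) (by have : (0:ℝ) ≤ n := by positivity
                                                linarith)
    calc (C1 * τ ^ n) * (C2 + Bg) + (n + 1) * (C3 * C2 * τ ^ n)
        = (C1 * (C2 + Bg)) * τ ^ n + (C3 * C2) * ((n + 1) * τ ^ n) := by ring
      _ ≤ (C1 * (C2 + Bg)) * (C0 * σ ^ n) + (C3 * C2) * (C0 * σ ^ n) := by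
          gcongr
          exact c1.trans hg1
      _ = _ := by ring

lemma RT.prod {L : Set ℂ} (hL : IsCompact L) {ρ : ℝ} (hρ : 0 ≤ ρ) {ι : Type*} (s : Finset ι)
    {f : ι → ℂ → ℂ} (hf : ∀ i ∈ s, RT L ρ (f i)) : RT L ρ (fun z => ∏ i ∈ s, f i z) := by
  classical
  induction s using Finset.induction_on with
  | empty => simpa using RT.const 1
  | insert a s ha ih =>
    simp only [Finset.prod_insert ha]
    exact (hf a (Finset.mem_insert_self a s)).mul hL hρ
      (ih fun i hi => hf i (Finset.mem_insert_of_mem hi))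

lemma iteratedDeriv_poly (p : Polynomial ℂ) (k : ℕ) :
    iteratedDeriv k (fun z => p.eval z) = fun z => (Polynomial.derivative^[k] p).eval z := by
  induction k with
  | zero => simp
  | succ k ih =>
    rw [iteratedDeriv_succ, ih, Function.iterate_succ_apply']
    ext z
    exact Polynomial.deriv _

lemma taylorSum_poly (p : Polynomial ℂ) (z₀ : ℂ) (n : ℕ) (hp : p.natDegree ≤ n) (z : ℂ) :
    taylorSum (fun z => p.eval z) z₀ n z = p.eval z := by
  unfold taylorSum
  rw [← Polynomial.taylor_eval_sub z₀ p z, Polynomial.eval_eq_sum_range' (n := n + 1)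
    (by rw [Polynomial.natDegree_taylor]; omega)]
  refine Finset.sum_congr rfl fun k _ => ?_
  rw [Polynomial.taylor_coeff, iteratedDeriv_poly]
  congr 1
  have h := congrArg (fun q => Polynomial.eval z₀ (q p))
    (Polynomial.factorial_smul_hasseDeriv (R := ℂ) k)
  simp only [LinearMap.smul_apply, Polynomial.eval_smul] at h
  rw [nsmul_eq_mul] at h
  simp only
  rw [← h]
  have : (k.factorial : ℂ) ≠ 0 := by exact_mod_cast k.factorial_ne_zero
  field_simp

lemma compl_aux {L A B U V : Set ℂ} (hB : IsClosed B) (hA : IsClosed A)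
    (hL : L = A ∪ B) (hne : Lᶜ.Nonempty) (hAB : Disjoint A B) (hU : IsOpen U) (hV : IsOpen V)
    (hUV : Aᶜ ⊆ U ∪ V) (hd : Aᶜ ∩ (U ∩ V) = ∅) (hLU : Lᶜ ⊆ U) : Aᶜ ⊆ U := by
  have e : B \ U = V ∩ Aᶜ := by
    ext x
    constructor
    · rintro ⟨hx, hxU⟩
      have hxA : x ∈ Aᶜ := fun h => Set.disjoint_left.mp hAB h hx
      exact ⟨(hUV hxA).resolve_left hxU, hxA⟩
    · rintro ⟨hx, hxA⟩
      have hxU : x ∉ U := fun h => by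
        have : x ∈ Aᶜ ∩ (U ∩ V) := ⟨hxA, h, hx⟩
        rw [hd] at this; exact this
      have hxL : x ∈ L := by
        by_contra h; exact hxU (hLU h)
      rw [hL] at hxL
      exact ⟨hxL.resolve_left hxA, hxU⟩
  have hcl : IsClopen (B \ U) := by
    refine ⟨?_, ?_⟩
    · exact hB.sdiff hU
    · rw [e]; exact hV.inter hA.isOpen_compl
  rcases isClopen_iff.mp hcl with h | h
  · intro x hx
    rcases hUV hx with h1 | h1
    · exact h1
    · have : x ∈ B \ U := by rw [e]; exact ⟨h1, hx⟩
      rw [h] at this; exact this.elim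
  · obtain ⟨y, hy⟩ := hne
    have : y ∈ B \ U := by rw [h]; trivial
    exact (this.2 (hLU hy)).elim

lemma compl_connected {L A B : Set ℂ} (hA : IsClosed A) (hB : IsClosed B) (hL : L = A ∪ B)
    (hAB : Disjoint A B) (hc : IsConnected Lᶜ) : IsConnected Aᶜ := by
  have hsub : Lᶜ ⊆ Aᶜ := by
    rw [hL]; exact Set.compl_subset_compl.mpr Set.subset_union_left
  refine ⟨hc.1.mono hsub, ?_⟩
  rw [isPreconnected_iff_subset_of_disjoint]
  intro U V hU hV hUV hd
  have h1 := isPreconnected_iff_subset_of_disjoint.mp hc.2 U V hU hV (hsub.trans hUV) (by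
    apply Set.eq_empty_of_subset_empty
    rw [← hd]
    exact Set.inter_subset_inter_left _ hsub)
  rcases h1 with h | h
  · exact Or.inl (compl_aux hB hA hL hc.1 hAB hU hV hUV hd h)
  · refine Or.inr (compl_aux hB hA hL hc.1 hAB hV hU (by rwa [Set.union_comm]) ?_ h)
    rwa [Set.inter_comm V U]

lemma supNorm_nonneg (g : ℂ → ℂ) (X : Set ℂ) : 0 ≤ supNorm g X := by
  apply Real.sSup_nonneg
  rintro _ ⟨z, _, rfl⟩
  exact norm_nonneg _

lemma supNorm_le {g : ℂ → ℂ} {X : Set ℂ} {c : ℝ} (hc : 0 ≤ c) (h : ∀ z ∈ X, ‖g z‖ ≤ c) :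
    supNorm g X ≤ c := by
  apply Real.sSup_le _ hc
  rintro _ ⟨z, hz, rfl⟩
  exact h z hz

lemma le_supNorm {g : ℂ → ℂ} {X : Set ℂ} {c : ℝ} (h : ∀ z ∈ X, ‖g z‖ ≤ c) {z : ℂ} (hz : z ∈ X) :
    ‖g z‖ ≤ supNorm g X := by
  apply le_csSup
  · refine ⟨c, ?_⟩
    rintro _ ⟨z, hz, rfl⟩
    exact h z hz
  · exact ⟨z, hz, rfl⟩

lemma dApprox_nonneg (L : Set ℂ) (G : ℂ → ℂ) (n : ℕ) : 0 ≤ dApprox L G n := by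
  apply Real.sInf_nonneg
  rintro _ ⟨p, _, rfl⟩
  exact supNorm_nonneg _ _

lemma dApprox_le {L : Set ℂ} {G : ℂ → ℂ} {B : ℝ} (hB0 : 0 ≤ B) (hB : ∀ z ∈ L, ‖G z‖ ≤ B) (n : ℕ) :
    dApprox L G n ≤ B := by
  have h : dApprox L G n ≤ supNorm (fun z => G z - Polynomial.eval z (0 : Polynomial ℂ)) L := by
    apply csInf_le
    · refine ⟨0, ?_⟩
      rintro _ ⟨p, _, rfl⟩
      exact supNorm_nonneg _ _
    · exact ⟨0, by simp, rfl⟩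
  refine h.trans (supNorm_le hB0 ?_)
  simpa using hB

lemma rho_bdd {L : Set ℂ} {G : ℂ → ℂ} {B : ℝ} (hB0 : 1 ≤ B) (hB : ∀ z ∈ L, ‖G z‖ ≤ B) :
    IsBoundedUnder (· ≤ ·) atTop (fun n : ℕ => dApprox L G n ^ (1 / (n : ℝ))) := by
  refine isBoundedUnder_of ⟨B, fun n => ?_⟩
  have h1 : (1 / (n : ℝ)) ≤ 1 := by
    rcases Nat.eq_zero_or_pos n with h | h
    · simp [h]
    · rw [div_le_one (by exact_mod_cast h)]; exact_mod_cast h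
  calc dApprox L G n ^ (1 / (n : ℝ)) ≤ B ^ (1 / (n : ℝ)) :=
        Real.rpow_le_rpow (dApprox_nonneg _ _ _) (dApprox_le (by linarith) hB n) (by positivity)
    _ ≤ B ^ (1 : ℝ) := Real.rpow_le_rpow_of_exponent_le hB0 h1
    _ = B := Real.rpow_one B

lemma rho_nonneg {L : Set ℂ} {G : ℂ → ℂ} {B : ℝ} (hB0 : 1 ≤ B) (hB : ∀ z ∈ L, ‖G z‖ ≤ B) :
    0 ≤ rho L G := by
  apply le_limsup_of_frequently_le _ (rho_bdd hB0 hB)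
  exact Frequently.of_forall fun n => Real.rpow_nonneg (dApprox_nonneg _ _ _) _

lemma lt_pow_of_rpow_lt {x σ : ℝ} {n : ℕ} (hx : 0 ≤ x) (hn : 1 ≤ n)
    (h : x ^ (1 / (n:ℝ)) < σ) : x < σ ^ n := by
  have h1 : (x ^ (1 / (n:ℝ))) ^ n = x := by
    rw [one_div]; exact Real.rpow_inv_natCast_pow hx (by omega)
  rw [← h1]
  exact pow_lt_pow_left₀ h (Real.rpow_nonneg hx _) (by omega)

lemma pow_lt_of_lt_rpow {x σ : ℝ} {n : ℕ} (hx : 0 ≤ x) (hσ : 0 ≤ σ) (hn : 1 ≤ n)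
    (h : σ < x ^ (1 / (n:ℝ))) : σ ^ n < x := by
  have h1 : (x ^ (1 / (n:ℝ))) ^ n = x := by
    rw [one_div]; exact Real.rpow_inv_natCast_pow hx (by omega)
  rw [← h1]
  exact pow_lt_pow_left₀ h hσ (by omega)

lemma RT_of_rho {L : Set ℂ} (hL : IsCompact L) {G : ℂ → ℂ} {B : ℝ} (hB0 : 1 ≤ B)
    (hB : ∀ z ∈ L, ‖G z‖ ≤ B) : RT L (rho L G) G := by
  intro σ h1 h2
  have hσ : 0 < σ := (rho_nonneg hB0 hB).trans_lt h1
  obtain ⟨N, hN⟩ := eventually_atTop.mp (eventually_lt_of_limsup_lt h1 (rho_bdd hB0 hB))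
  have hσN : 0 < σ ^ (N + 1) := by positivity
  refine ⟨1 + B / σ ^ (N + 1), by positivity, fun n => ?_⟩
  by_cases hn : N + 1 ≤ n
  · have h3 := lt_pow_of_rpow_lt (dApprox_nonneg _ _ _) (by omega) (hN n (by omega))
    have hne : {c : ℝ | ∃ p : Polynomial ℂ, p.degree ≤ (n : ℕ) ∧
        c = supNorm (fun z => G z - Polynomial.eval z p) L}.Nonempty :=
      ⟨supNorm (fun z => G z - Polynomial.eval z 0) L, (0 : Polynomial ℂ), by simp, rfl⟩
    obtain ⟨c, ⟨p, hp, rfl⟩, hc⟩ := exists_lt_of_csInf_lt hne h3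
    refine ⟨p, Polynomial.natDegree_le_of_degree_le hp, fun z hz => ?_⟩
    obtain ⟨C, _, hC⟩ := poly_bdd hL p
    have h4 : ‖G z - p.eval z‖ ≤ supNorm (fun z => G z - Polynomial.eval z p) L :=
      le_supNorm (g := fun z => G z - Polynomial.eval z p) (c := B + C)
        (fun w hw => (norm_sub_le _ _).trans (add_le_add (hB w hw) (hC w hw))) hz
    have h5 : 0 ≤ B / σ ^ (N + 1) * σ ^ n := by positivity
    rw [add_mul, one_mul]
    linarith
  · push Not at hn
    refine ⟨0, by simp, fun z hz => ?_⟩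
    have h6 : σ ^ (N + 1) ≤ σ ^ n := pow_le_pow_of_le_one hσ.le h2.le (by omega)
    have h7 : B ≤ B / σ ^ (N + 1) * σ ^ n := by
      rw [div_mul_eq_mul_div, le_div_iff₀ hσN]
      gcongr
    have h8 := hB z hz
    have h9 : 0 < σ ^ n := by positivity
    simp only [Polynomial.eval_zero, sub_zero]
    rw [add_mul, one_mul]
    linarith

/-- Proposition 2.5: under the limit-point hypothesis, for every nonzero polynomial `u` with
coefficients in `ℚ + iℚ` and every `s ≥ 1`, the set `⋃_{n ≥ 1} V(u,s,n)` is dense in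
`(A(K₀), ‖·‖_{K₀})`. -/
theorem stmt6 (m₀ : ℕ) (hm : 1 ≤ m₀) (K : Fin (m₀ + 1) → Set ℂ)
    (hKc : ∀ i, IsCompact (K i)) (hKconn : ∀ i, IsConnected (K i))
    (hKdisj : ∀ i j, i ≠ j → Disjoint (K i) (K j))
    (hK0 : (interior (K 0)).Nonempty) (hKnt : ∀ i, i ≠ 0 → (K i).Nontrivial)
    (L : Set ℂ) (hL : L = ⋃ i, K i) (hLcc : IsConnected Lᶜ)
    (P : Set ℂ) (hP : P = L \ K 0) (z₀ : ℂ) (hz₀ : z₀ ∈ interior (K 0))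
    (F : ℂ → ℂ) (hF : ∀ i : Fin (m₀ + 1), ∀ z ∈ K i, F z = ((i : ℕ) : ℂ)) (β : ℕ → ℂ)
    (hlim : ∃ a ∈ Set.Ioo (rho L F) (1 / rho L F),
      MapClusterPt a Filter.atTop (fun n : ℕ => ‖β n‖ ^ (1 / (n : ℝ))))
    (u : Polynomial ℂ) (hu : u ≠ 0) (hur : ratCoeffs u) (s : ℕ) (hs : 1 ≤ s) :
    denseInA (K 0) (⋃ (n : ℕ) (_ : 1 ≤ n), Vset z₀ (K 0) P β u s n) := by
  have hLc : IsCompact L := by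
    rw [hL]; exact isCompact_iUnion hKc
  have hFB : ∀ z ∈ L, ‖F z‖ ≤ (m₀ : ℝ) := by
    intro z hz
    rw [hL] at hz
    obtain ⟨i, hi⟩ := Set.mem_iUnion.mp hz
    rw [hF i z hi, Complex.norm_natCast]
    exact_mod_cast Nat.lt_succ_iff.mp i.2
  have hm1 : (1:ℝ) ≤ m₀ := by exact_mod_cast hm
  have hρ0 : 0 ≤ rho L F := rho_nonneg hm1 hFB
  have hRT : RT L (rho L F) F := RT_of_rho hLc hm1 hFB
  obtain ⟨a, ⟨ha1, ha2⟩, hacl⟩ := hlim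
  set ρ := rho L F with hρdef
  have hρpos : 0 < ρ := by
    rcases hρ0.eq_or_lt with h | h
    · rw [← h] at ha1 ha2
      simp only [div_zero] at ha2
      linarith
    · exact h
  have ha0 : 0 < a := hρpos.trans ha1
  have hρa : ρ * a < 1 := by
    rw [lt_div_iff₀ hρpos] at ha2; linarith
  have hρ1 : ρ < 1 := by nlinarith
  obtain ⟨σ, hσ1, hσ2⟩ : ∃ σ, ρ < σ ∧ σ < min 1 (min a (1 / a)) := by
    apply exists_between
    refine lt_min hρ1 (lt_min ha1 ?_)
    rw [lt_div_iff₀ ha0]; exact hρa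
  have hσone : σ < 1 := hσ2.trans_le (min_le_left _ _)
  have hσa : σ < a := hσ2.trans_le ((min_le_right _ _).trans (min_le_left _ _))
  have hσa' : σ < 1 / a := hσ2.trans_le ((min_le_right _ _).trans (min_le_right _ _))
  have hσ0 : 0 < σ := hρpos.trans hσ1
  obtain ⟨a1, hσa1, ha1a⟩ := exists_between hσa
  have haσ : a < 1 / σ := by
    rw [lt_div_iff₀ ha0] at hσa'
    rw [lt_div_iff₀ hσ0]; linarith
  obtain ⟨a2, haa2, ha2σ⟩ := exists_between haσ
  have hσa2 : σ * a2 < 1 := by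
    rw [lt_div_iff₀ hσ0] at ha2σ; linarith
  have ha10 : 0 < a1 := hσ0.trans hσa1
  have ha20 : 0 < a2 := ha0.trans haa2
  -- the characteristic function
  set χ : ℂ → ℂ := fun z => ∏ i ∈ Finset.Icc 1 m₀, (-(i : ℂ))⁻¹ * (F z - i) with hχ
  have hχRT : RT L ρ χ := RT.prod hLc hρ0 _ fun i _ => hRT.affine _ _
  have hχ0 : ∀ z ∈ K 0, χ z = 1 := by
    intro z hz
    apply Finset.prod_eq_one
    intro i hi
    have hi1 : 1 ≤ i := (Finset.mem_Icc.mp hi).1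
    have : (i : ℂ) ≠ 0 := by exact_mod_cast (by omega : i ≠ 0)
    rw [hF 0 z hz]
    simp only [Fin.val_zero, Nat.cast_zero, zero_sub]
    exact inv_mul_cancel₀ (neg_ne_zero.mpr this)
  have hχ1 : ∀ z ∈ P, χ z = 0 := by
    intro z hz
    rw [hP, hL] at hz
    obtain ⟨j, hj⟩ := Set.mem_iUnion.mp hz.1
    have hj0 : j ≠ 0 := by
      rintro rfl; exact hz.2 hj
    have hj0' : (j : ℕ) ≠ 0 := fun h => hj0 (Fin.ext h)
    apply Finset.prod_eq_zero (i := (j : ℕ))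
    · rw [Finset.mem_Icc]
      exact ⟨by omega, Nat.lt_succ_iff.mp j.2⟩
    · rw [hF j z hj]; simp
  have hPL : P ⊆ L := by rw [hP]; exact Set.sdiff_subset
  have hK0L : K 0 ⊆ L := by rw [hL]; exact Set.subset_iUnion K 0
  -- connectedness of the complement of `K 0`
  have hcomp : IsConnected (K 0)ᶜ := by
    refine compl_connected (L := L) (B := ⋃ i ∈ {i : Fin (m₀ + 1) | i ≠ 0}, K i)
      (hKc 0).isClosed ?_ ?_ ?_ hLcc
    · exact ((Set.toFinite _).isCompact_biUnion fun i _ => hKc i).isClosed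
    · rw [hL]
      ext z
      simp only [Set.mem_iUnion, Set.mem_union, Set.mem_ofPred_eq]
      constructor
      · rintro ⟨i, hi⟩
        by_cases h : i = 0
        · left; rw [← h]; exact hi
        · right; exact ⟨i, h, hi⟩
      · rintro (h | ⟨i, _, hi⟩)
        · exact ⟨0, h⟩
        · exact ⟨i, hi⟩
    · rw [Set.disjoint_iUnion₂_right]
      intro i hi
      exact hKdisj 0 i (Ne.symm hi)
  intro g hg ε hε
  obtain ⟨G, hG⟩ := mergelyan (hKc 0) hcomp hg.1 hg.2 (ε / 4) (by positivity)
  obtain ⟨B1, hB1, hGB⟩ := poly_bdd hLc G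
  obtain ⟨B2, hB2, huB⟩ := poly_bdd hLc u
  obtain ⟨C, hC, hχn⟩ := hχRT σ hσ1 hσone
  choose Q hQd hQ using hχn
  set d := G.natDegree + u.natDegree with hd
  set M := C * (σ ^ d)⁻¹ with hM
  have hM0 : 0 ≤ M := by positivity
  have hspos : (0:ℝ) < s := by exact_mod_cast hs
  -- limits
  have t1 : Tendsto (fun n : ℕ => M * (B1 * σ ^ n + B2 * (σ / a1) ^ n)) atTop (𝓝 0) := by
    have h1 := (tendsto_pow_atTop_nhds_zero_of_lt_one hσ0.le hσone).const_mul B1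
    have h2 := (tendsto_pow_atTop_nhds_zero_of_lt_one (r := σ / a1) (by positivity)
      ((div_lt_one ha10).mpr hσa1)).const_mul B2
    simpa using (h1.add h2).const_mul M
  have t2 : Tendsto (fun n : ℕ => M * (B1 * (σ * a2) ^ n + B2 * σ ^ n)) atTop (𝓝 0) := by
    have h1 := (tendsto_pow_atTop_nhds_zero_of_lt_one (r := σ * a2) (by positivity)
      hσa2).const_mul B1
    have h2 := (tendsto_pow_atTop_nhds_zero_of_lt_one hσ0.le hσone).const_mul B2
    simpa using (h1.add h2).const_mul M
  have f1 := hacl.frequently (Ioo_mem_nhds ha1a haa2)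
  have f2 := f1.and_eventually ((eventually_ge_atTop (d + 1)).and
    ((t1.eventually_lt_const (show 0 < ε / 4 by positivity)).and
      (t2.eventually_lt_const (show 0 < 1 / (2 * (s:ℝ)) by positivity))))
  obtain ⟨n, ⟨hn1, hn2⟩, hnd, hl1, hl2⟩ := f2.exists
  have hn : 1 ≤ n := by omega
  have hβ1 : a1 ^ n < ‖β n‖ := pow_lt_of_lt_rpow (norm_nonneg _) ha10.le hn hn1
  have hβ2 : ‖β n‖ < a2 ^ n := lt_pow_of_rpow_lt (norm_nonneg _) hn hn2
  have hβ0 : 0 < ‖β n‖ := (pow_pos ha10 n).trans hβ1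
  have hβne : β n ≠ 0 := norm_pos_iff.mp hβ0
  set N := n - d with hN
  have hσN : C * σ ^ N = M * σ ^ n := by
    have : σ ^ n = σ ^ N * σ ^ d := by rw [← pow_add]; congr 1; omega
    rw [hM, this]
    field_simp
  set p : Polynomial ℂ := G * Q N + Polynomial.C (β n)⁻¹ * u * (1 - Q N) with hp
  have hpd : p.natDegree ≤ n := by
    refine (Polynomial.natDegree_add_le _ _).trans (max_le ?_ ?_)
    · refine Polynomial.natDegree_mul_le.trans ?_
      have := hQd N
      omega
    · refine Polynomial.natDegree_mul_le.trans ?_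
      have h1 : (Polynomial.C (β n)⁻¹ * u).natDegree ≤ u.natDegree :=
        Polynomial.natDegree_C_mul_le _ _
      have h2 : (1 - Q N).natDegree ≤ N := by
        refine (Polynomial.natDegree_sub_le _ _).trans (max_le (by simp) (hQd N))
      omega
  have hpe : ∀ z, p.eval z = G.eval z * (Q N).eval z + (β n)⁻¹ * u.eval z * (1 - (Q N).eval z) := by
    intro z; simp [hp]
  refine ⟨fun z => p.eval z, ?_, ?_⟩
  · rw [Set.mem_iUnion₂]
    refine ⟨n, hn, ⟨p.continuous.continuousOn, p.differentiable.differentiableOn⟩, ?_⟩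
    refine lt_of_le_of_lt (supNorm_le (c := 1 / (2 * (s:ℝ))) (by positivity) fun z hz => ?_) ?_
    · rw [taylorSum_poly p z₀ n hpd, hpe]
      have h1 := hQ N z (hPL hz)
      rw [hχ1 z hz, zero_sub, norm_neg, hσN] at h1
      have e : β n * (G.eval z * (Q N).eval z + (β n)⁻¹ * u.eval z * (1 - (Q N).eval z)) - u.eval z
          = (Q N).eval z * (β n * G.eval z - u.eval z) := by
        field_simp
        ring
      rw [e, norm_mul]
      have h2 : ‖β n * G.eval z - u.eval z‖ ≤ a2 ^ n * B1 + B2 := by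
        refine (norm_sub_le _ _).trans ?_
        rw [norm_mul]
        exact add_le_add (mul_le_mul hβ2.le (hGB z (hPL hz)) (norm_nonneg _) (by positivity))
          (huB z (hPL hz))
      calc _ ≤ (M * σ ^ n) * (a2 ^ n * B1 + B2) :=
            mul_le_mul h1 h2 (norm_nonneg _) (by positivity)
        _ = M * (B1 * (σ * a2) ^ n + B2 * σ ^ n) := by rw [mul_pow]; ring
        _ ≤ _ := hl2.le
    · apply one_div_lt_one_div_of_lt hspos
      linarith
  · refine lt_of_le_of_lt (supNorm_le (c := ε / 2) (by positivity) fun z hz => ?_) (by linarith)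
    simp only [hpe]
    have h1 := hQ N z (hK0L hz)
    rw [hχ0 z hz, hσN] at h1
    have e : G.eval z * (Q N).eval z + (β n)⁻¹ * u.eval z * (1 - (Q N).eval z) - g z
        = -(g z - G.eval z) - (1 - (Q N).eval z) * (G.eval z - (β n)⁻¹ * u.eval z) := by ring
    rw [e]
    refine (norm_sub_le _ _).trans ?_
    rw [norm_neg, norm_mul]
    have h3 := hG z hz
    have h2 : ‖G.eval z - (β n)⁻¹ * u.eval z‖ ≤ B1 + (a1 ^ n)⁻¹ * B2 := by
      refine (norm_sub_le _ _).trans ?_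
      rw [norm_mul, norm_inv]
      have : ‖β n‖⁻¹ ≤ (a1 ^ n)⁻¹ := inv_anti₀ (pow_pos ha10 n) hβ1.le
      exact add_le_add (hGB z (hK0L hz))
        (mul_le_mul this (huB z (hK0L hz)) (norm_nonneg _) (by positivity))
    have h4 : ‖1 - (Q N).eval z‖ * ‖G.eval z - (β n)⁻¹ * u.eval z‖ ≤ ε / 4 := by
      calc _ ≤ (M * σ ^ n) * (B1 + (a1 ^ n)⁻¹ * B2) :=
            mul_le_mul h1 h2 (norm_nonneg _) (by positivity)
        _ = M * (B1 * σ ^ n + B2 * (σ / a1) ^ n) := by rw [div_pow]; field_simp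
        _ ≤ _ := hl1.le
    linarith
end

section
/- Let L = ⋃_{i=0}^{m₀} K_i be a compact subset of ℂ with connected complement, where m₀ ≥ 1 and K₀, …, K_{m₀} are the connected components of L, K₀ has nonempty interior, and each K_i with 1 ≤ i ≤ m₀ contains more than one point. Let Π := L ∖ K₀ and fix z₀ in the interior of K₀. Set R₀ := dist(z₀, Π) and r₀ := dist(z₀, ℂ ∖ K₀). If (β_n)_{n≥1} is a sequence of complex numbers with limsup_{n→∞} |β_n|^{1/n} < r₀/R₀ (in particular limsup |β_n|^{1/n} ∈ [0, r₀/R₀)), then U(z₀, K₀, Π, (β_n)) = ∅. -/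
open Filter Topology Metric

/-- The universal class `U(z₀, K₀, Π, (β_n))`: elements `f` of `A(K₀)` such that
`{β_n · S_n(f, z₀)|_Π : n ≥ 1}` is dense in `A(Π)` for the sup norm on `Π`. -/
def Uuniv (z₀ : ℂ) (K₀ P : Set ℂ) (β : ℕ → ℂ) : Set (ℂ → ℂ) :=
  {f | memA K₀ f ∧ ∀ h : ℂ → ℂ, memA P h → ∀ ε : ℝ, 0 < ε →
    ∃ n : ℕ, 1 ≤ n ∧ supNorm (fun z => β n * taylorSum f z₀ n z - h z) P < ε}

/-- Proposition 4.1: with `R₀ := dist(z₀, Π)` and `r₀ := dist(z₀, ℂ ∖ K₀)`, if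
`limsup |β_n|^{1/n} < r₀/R₀` then `U(z₀, K₀, Π, (β_n)) = ∅`. -/
theorem stmt7 (m₀ : ℕ) (hm : 1 ≤ m₀) (K : Fin (m₀ + 1) → Set ℂ)
    (hKc : ∀ i, IsCompact (K i)) (hKconn : ∀ i, IsConnected (K i))
    (hKdisj : ∀ i j, i ≠ j → Disjoint (K i) (K j))
    (hK0 : (interior (K 0)).Nonempty) (hKnt : ∀ i, i ≠ 0 → (K i).Nontrivial)
    (L : Set ℂ) (hL : L = ⋃ i, K i) (hLcc : IsConnected Lᶜ)
    (P : Set ℂ) (hP : P = L \ K 0) (z₀ : ℂ) (hz₀ : z₀ ∈ interior (K 0)) (β : ℕ → ℂ)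
    (hlim : Filter.limsup (fun n : ℕ => ((‖β n‖ ^ (1 / (n : ℝ)) : ℝ) : EReal))
        Filter.atTop
      < ((Metric.infDist z₀ (K 0)ᶜ / Metric.infDist z₀ P : ℝ) : EReal)) :
    Uuniv z₀ (K 0) P β = ∅ := by
  have hPeq : P = ⋃ i ∈ {i : Fin (m₀ + 1) | i ≠ 0}, K i := by
    subst hP hL
    ext z
    simp only [Set.mem_sdiff, Set.mem_iUnion, Set.mem_ofPred_eq, exists_prop]
    constructor
    · rintro ⟨⟨i, hi⟩, h0⟩
      refine ⟨i, ?_, hi⟩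
      rintro rfl
      exact h0 hi
    · rintro ⟨i, hi, hz⟩
      exact ⟨⟨i, hz⟩, fun h0 => Set.disjoint_left.1 (hKdisj i 0 hi) hz h0⟩
  have hPc : IsCompact P := by
    rw [hPeq]
    exact (Set.toFinite _).isCompact_biUnion fun i _ => hKc i
  have hPne : P.Nonempty := by
    have h1 : (Fin.last m₀) ≠ 0 := by
      intro h
      have := congrArg Fin.val h
      simp at this
      omega
    obtain ⟨z, hz⟩ := (hKconn (Fin.last m₀)).nonempty
    refine ⟨z, ?_⟩
    rw [hPeq]
    exact Set.mem_biUnion h1 hz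
  obtain ⟨z₁, hz₁, hR⟩ := hPc.exists_infDist_eq_dist hPne z₀
  have hz₁c : z₁ ∈ (K 0)ᶜ := by rw [hP] at hz₁; exact hz₁.2
  have hrR : infDist z₀ (K 0)ᶜ ≤ dist z₀ z₁ := infDist_le_dist_of_mem hz₁c
  rw [hR] at hlim
  set r₀ := infDist z₀ (K 0)ᶜ with hr₀
  set R := dist z₀ z₁ with hRdef
  have hR0 : 0 < R := by
    apply dist_pos.2
    rintro rfl
    exact hz₁c (interior_subset hz₀)
  obtain ⟨q, hq1, hq2⟩ := EReal.lt_iff_exists_real_btwn.1 hlim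
  have hq2 : q < r₀ / R := by exact_mod_cast hq2
  have hev := eventually_lt_of_limsup_lt hq1
  have hq0 : 0 ≤ q := by
    obtain ⟨n, hn⟩ := hev.exists
    have hn : ‖β n‖ ^ (1 / (n : ℝ)) < q := by exact_mod_cast hn
    exact le_trans (by positivity) hn.le
  have hqR : q * R < r₀ := (lt_div_iff₀ hR0).1 hq2
  obtain ⟨r, hr1, hr2⟩ := exists_between hqR
  have hr : 0 < r := lt_of_le_of_lt (by positivity) hr1
  have hball : closedBall z₀ r ⊆ interior (K 0) := by
    have : ball z₀ r₀ ⊆ K 0 := by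
      have := ball_infDist_compl_subset (s := K 0) (x := z₀)
      exact this
    exact (closedBall_subset_ball hr2).trans (interior_maximal this isOpen_ball)
  rw [Set.eq_empty_iff_forall_notMem]
  rintro f ⟨⟨-, hfd⟩, hf⟩
  have hdc : DiffContOnCl ℂ f (ball z₀ r) := by
    apply DifferentiableOn.diffContOnCl
    rw [closure_ball z₀ hr.ne']
    exact hfd.mono hball
  obtain ⟨M, hM⟩ := (isCompact_sphere z₀ r).exists_bound_of_continuousOn
    ((hfd.continuousOn.mono hball).mono sphere_subset_closedBall)
  have hM0 : ∀ z ∈ sphere z₀ r, ‖f z‖ ≤ max M 0 := fun z hz => (hM z hz).trans (le_max_left _ _)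
  generalize hMM : max M 0 = M' at hM0
  have hM' : 0 ≤ M' := hMM ▸ le_max_right _ _
  have hS : ∀ n, ‖taylorSum f z₀ n z₁‖ ≤ (n + 1) * (M' * (R / r) ^ n) := by
    intro n
    unfold taylorSum
    refine (norm_sum_le_of_le (Finset.range (n+1)) (f := fun k => (iteratedDeriv k f z₀ / (Nat.factorial k)) * (z₁ - z₀) ^ k) (n := fun _ => M' * (R / r) ^ n) ?_).trans ?_
    · intro k hk
      have hc := Complex.norm_iteratedDeriv_le_of_forall_mem_sphere_norm_le k hr hdc hM0
      have hkf : (0 : ℝ) < (Nat.factorial k) := by exact_mod_cast Nat.factorial_pos k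
      have hd : ‖z₁ - z₀‖ = R := by rw [hRdef, dist_comm, dist_eq_norm]
      rw [norm_mul, norm_div, norm_pow, hd, Complex.norm_natCast]
      have h1 : ‖iteratedDeriv k f z₀‖ / (Nat.factorial k) ≤ M' / r ^ k := by
        rw [div_le_iff₀ hkf]
        refine hc.trans (le_of_eq ?_)
        ring
      calc _ ≤ M' / r ^ k * R ^ k := by gcongr
        _ = M' * (R / r) ^ k := by rw [div_pow]; ring
        _ ≤ _ := by
          have h2 : 1 ≤ R / r := (one_le_div hr).2 (hr2.le.trans hrR)
          have h3 : k ≤ n := by simpa [Nat.lt_succ_iff] using hk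
          gcongr
    · simp
  have htend : Tendsto (fun n => β n * taylorSum f z₀ n z₁) atTop (𝓝 0) := by
    have ht1 : q * R / r < 1 := (div_lt_one hr).2 hr1
    have ht0 : 0 ≤ q * R / r := by positivity
    have hA := tendsto_self_mul_const_pow_of_lt_one ht0 ht1
    have hB := tendsto_pow_atTop_nhds_zero_of_lt_one ht0 ht1
    have hC : Tendsto (fun n : ℕ => M' * (n * (q * R / r) ^ n + (q * R / r) ^ n)) atTop (𝓝 0) := by
      simpa using (hA.add hB).const_mul M'
    refine squeeze_zero_norm' ?_ hC
    filter_upwards [hev, eventually_ge_atTop 1] with n hn hn1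
    have hn : ‖β n‖ ^ (1 / (n : ℝ)) < q := by exact_mod_cast hn
    have hb : ‖β n‖ ≤ q ^ n := by
      have := pow_le_pow_left₀ (by positivity) hn.le n
      rwa [one_div, Real.rpow_inv_natCast_pow (norm_nonneg _) (by omega)] at this
    rw [norm_mul]
    calc _ ≤ q ^ n * ((n + 1) * (M' * (R / r) ^ n)) :=
          mul_le_mul hb (hS n) (norm_nonneg _) (by positivity)
      _ = _ := by rw [div_pow, div_pow, mul_pow]; ring
  obtain ⟨B, hB⟩ := htend.norm.bddAbove_range
  have hBn : ∀ n, ‖β n * taylorSum f z₀ n z₁‖ ≤ B := fun n => hB ⟨n, rfl⟩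
  have hB0 : 0 ≤ B := (norm_nonneg _).trans (hBn 0)
  obtain ⟨n, -, hn⟩ := hf (fun _ => ((B + 1 : ℝ) : ℂ))
    ⟨continuousOn_const, differentiableOn_const _⟩ 1 one_pos
  have hcont : Continuous (fun z => ‖β n * taylorSum f z₀ n z - ((B + 1 : ℝ) : ℂ)‖) := by
    unfold taylorSum
    fun_prop
  have hle : ‖β n * taylorSum f z₀ n z₁ - ((B + 1 : ℝ) : ℂ)‖ < 1 :=
    lt_of_le_of_lt (le_csSup (hPc.image hcont).bddAbove ⟨z₁, hz₁, rfl⟩) hn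
  have h1 := norm_sub_norm_le ((B + 1 : ℝ) : ℂ) (β n * taylorSum f z₀ n z₁)
  rw [norm_sub_rev, Complex.norm_real, Real.norm_of_nonneg (by positivity)] at h1
  linarith [hBn n]
end

section
/- Let K ⊆ ℂ be a compact set disjoint from the closed unit disc D̄, containing more than one point, connected, and with connected complement, and set L := D̄ ∪ K (so the connected components of L are K₀ := D̄ and K₁ := K). Then 1/dist(0,K) < ρ_L, where dist(0,K) := inf{|w| : w ∈ K}. -/
open Filter Topology Metric

open Polynomial in
lemma aux_bernstein (n : ℕ) (p : Polynomial ℂ) (hp : p.natDegree ≤ n) (M : ℝ)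
    (hM : ∀ z ∈ Metric.closedBall (0:ℂ) 1, ‖p.eval z‖ ≤ M) (w : ℂ) (hw : 1 ≤ ‖w‖) :
    ‖p.eval w‖ ≤ M * ‖w‖ ^ n := by
  have key : ∀ x : ℂ, x ≠ 0 → (reflect n p).eval x⁻¹ * x ^ n = p.eval x := by
    intro x hx
    have := invertibleOfNonzero hx
    have := eval₂_reflect_mul_pow (RingHom.id ℂ) x n p hp
    simpa [eval₂_id, invOf_eq_inv] using this
  have hw0 : w ≠ 0 := by
    rintro rfl
    norm_num at hw
  have h1 : ‖(reflect n p).eval w⁻¹‖ ≤ M := by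
    refine Complex.norm_le_of_forall_mem_frontier_norm_le (U := Metric.ball (0:ℂ) 1)
      Metric.isBounded_ball (f := fun z => (reflect n p).eval z)
      (reflect n p).differentiable.diffContOnCl ?_ ?_
    · intro z hz
      rw [frontier_ball _ one_ne_zero] at hz
      have hz1 : ‖z‖ = 1 := by simpa using hz
      have hz0 : z ≠ 0 := by
        rintro rfl
        norm_num at hz1
      have := key z⁻¹ (inv_ne_zero hz0)
      rw [inv_inv] at this
      have h2 := hM z⁻¹ (by simp [hz1])
      rw [← this] at h2
      simpa [hz1] using h2
    · rw [closure_ball _ one_ne_zero]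
      simpa using inv_le_one_of_one_le₀ hw
  rw [← key w hw0, norm_mul, norm_pow]
  gcongr

open Polynomial Polynomial.Chebyshev in
lemma aux_walsh (n : ℕ) (K : Set ℂ) (z₀ : ℂ) (R : ℝ) (hR : 0 < R)
    (hK : ∀ s ∈ Set.Icc 0 R, ∃ ζ ∈ K, ‖ζ - z₀‖ = s)
    (q : Polynomial ℂ) (hq : q.degree ≤ (n : ℕ)) (M : ℝ)
    (hM : ∀ z ∈ K, ‖q.eval z‖ ≤ M) (θ : ℝ) (w : ℂ)
    (hw : ‖w - z₀‖ ≤ R / 2 * (Real.cosh θ - 1)) :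
    ‖q.eval w‖ ≤ M * Real.cosh (n * θ) := by
  have hex : ∀ i : ℕ, ∃ ζ ∈ K, ‖ζ - z₀‖ = R / 2 * (1 - node n i) := by
    intro i
    apply hK
    have := node_mem_Icc (n := n) (i := i)
    constructor
    · have := this.2
      have : 0 ≤ 1 - node n i := by linarith
      positivity
    · nlinarith [this.1]
  choose ζ hζK hζ using hex
  have hinj : Set.InjOn (fun i => node n i) (Finset.range (n + 1)) := (strictAntiOn_node n).injOn
  have hinj2 : Set.InjOn ζ (Finset.range (n + 1)) := by
    intro i hi j hj hij
    apply hinj hi hj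
    have h1 := hζ i
    rw [hij, hζ j] at h1
    have : (1 - node n j) = 1 - node n i := mul_left_cancel₀ (by positivity) h1
    simp only
    linarith
  have hM0 : 0 ≤ M := (norm_nonneg _).trans (hM _ (hζK 0))
  have hqi := Lagrange.eq_interpolate (s := Finset.range (n + 1)) (v := ζ) (f := q) hinj2
    (lt_of_le_of_lt hq (by simp only [Finset.card_range]; exact_mod_cast Nat.lt_succ_self n))
  have hTi := Lagrange.eq_interpolate (s := Finset.range (n + 1)) (v := fun i => node n i)
    (f := T ℝ n) hinj
    (by rw [degree_T]; simp only [Finset.card_range, Int.natAbs_natCast]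
        exact_mod_cast Nat.lt_succ_self n)
  have hy : 1 ≤ Real.cosh θ := Real.one_le_cosh θ
  have hT : Real.cosh (n * θ) = ∑ i ∈ Finset.range (n + 1),
      ∏ j ∈ (Finset.range (n + 1)).erase i, (Real.cosh θ - node n j) / |node n i - node n j| := by
    have h1 := T_real_cosh θ n
    rw [hTi] at h1
    rw [Lagrange.interpolate_apply, eval_finsetSum] at h1
    push_cast at h1
    rw [← h1]
    refine Finset.sum_congr rfl fun i hi => ?_
    have hin : i ≤ n := by simpa [Nat.lt_succ_iff] using hi
    rw [eval_mul, eval_C, eval_T_real_node (by simpa using hin), Lagrange.basis, eval_prod]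
    have hpos := zero_lt_prod_node_sub_node hin
    simp only [Lagrange.basisDivisor, eval_mul, eval_C, eval_sub, eval_X]
    rw [Finset.prod_mul_distrib, Finset.prod_div_distrib, Finset.prod_inv_distrib,
      ← Finset.abs_prod]
    set P := ∏ j ∈ (Finset.range (n + 1)).erase i, (node n i - node n j)
    have habs : |P| = (-1) ^ i * P := by
      rw [← abs_of_pos hpos, abs_mul, abs_neg_one_pow, one_mul]
    have hP : P ≠ 0 := by
      intro h
      rw [h] at hpos
      simp at hpos
    rw [habs]
    have h2 : ((-1 : ℝ) ^ i) * (-1) ^ i = 1 := by rw [← mul_pow]; simp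
    have h3 : ((-1 : ℝ) ^ i) ≠ 0 := by simp
    field_simp
    rw [sq, h2, one_mul]
  rw [hqi, Lagrange.interpolate_apply, eval_finsetSum, hT, Finset.mul_sum]
  refine (norm_sum_le _ _).trans (Finset.sum_le_sum fun i hi => ?_)
  rw [eval_mul, eval_C, norm_mul]
  refine mul_le_mul (hM _ (hζK i)) ?_ (norm_nonneg _) hM0
  rw [Lagrange.basis, eval_prod, norm_prod]
  refine Finset.prod_le_prod (fun _ _ => norm_nonneg _) fun j hj => ?_
  simp only [Lagrange.basisDivisor, eval_mul, eval_C, eval_sub, eval_X, norm_mul, norm_inv]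
  have hji := Finset.mem_erase.1 hj
  have hne : node n i ≠ node n j := fun h => hji.1 (hinj hji.2 hi h.symm)
  have hpos : 0 < |node n i - node n j| := abs_pos.2 (sub_ne_zero.2 hne)
  have hd : R / 2 * |node n i - node n j| ≤ ‖ζ i - ζ j‖ := by
    have h1 := abs_norm_sub_norm_le (ζ i - z₀) (ζ j - z₀)
    rw [hζ, hζ, sub_sub_sub_cancel_right] at h1
    refine le_trans (le_of_eq ?_) h1
    rw [← mul_sub, abs_mul, abs_of_pos (by positivity : 0 < R / 2), abs_sub_comm]
    congr 2
    ring
  have hn : ‖w - ζ j‖ ≤ R / 2 * (Real.cosh θ - node n j) := by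
    have h1 : ‖w - ζ j‖ ≤ ‖w - z₀‖ + ‖ζ j - z₀‖ := by
      have := norm_sub_le (w - z₀) (ζ j - z₀)
      rwa [sub_sub_sub_cancel_right] at this
    rw [hζ] at h1
    linarith
  rw [inv_mul_eq_div]
  calc ‖w - ζ j‖ / ‖ζ i - ζ j‖ ≤ (R / 2 * (Real.cosh θ - node n j)) / (R / 2 * |node n i - node n j|) := by
        apply div_le_div₀ ((norm_nonneg _).trans hn) hn (by positivity) hd
    _ = _ := mul_div_mul_left _ _ (by positivity)

lemma aux_lower (K : Set ℂ)
    (hKc : IsCompact K) (hKD : Disjoint K (Metric.closedBall (0:ℂ) 1))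
    (hKnt : K.Nontrivial) (hKconn : IsConnected K) :
    1 < Metric.infDist (0:ℂ) K ∧ ∃ m : ℝ, 1 ≤ m ∧ m < Metric.infDist (0:ℂ) K ∧
      ∀ (n : ℕ) (p : Polynomial ℂ) (ε : ℝ), p.degree ≤ (n : ℕ) →
        (∀ z ∈ Metric.closedBall (0:ℂ) 1, ‖p.eval z‖ ≤ ε) → (∀ z ∈ K, ‖1 - p.eval z‖ ≤ ε) →
        1 / 2 * (1 / m) ^ n ≤ ε := by
  obtain ⟨z₀, hz₀, hr⟩ := hKc.exists_infDist_eq_dist hKconn.nonempty 0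
  rw [dist_zero_left] at hr
  rw [hr]
  set r := ‖z₀‖ with hrdef
  have hr1 : 1 < r := by
    by_contra h
    exact Set.disjoint_left.1 hKD hz₀ (by simpa using not_lt.1 h)
  refine ⟨hr1, ?_⟩
  obtain ⟨z₁, hz₁, hne⟩ := hKnt.exists_ne z₀
  set R := ‖z₁ - z₀‖ with hRdef
  have hR : 0 < R := norm_pos_iff.2 (sub_ne_zero.2 hne)
  have hK : ∀ s ∈ Set.Icc 0 R, ∃ ζ ∈ K, ‖ζ - z₀‖ = s := by
    intro s hs
    have hc : ContinuousOn (fun ζ : ℂ => ‖ζ - z₀‖) K := by fun_prop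
    have := hKconn.isPreconnected.intermediate_value hz₀ hz₁ hc
    obtain ⟨ζ, h1, h2⟩ := this (by simpa using hs)
    exact ⟨ζ, h1, h2⟩
  set θ := Real.log r / 2 with hθ
  have hlog : 0 < Real.log r := Real.log_pos hr1
  have hθ0 : 0 < θ := by positivity
  have hcosh : 1 < Real.cosh θ := Real.one_lt_cosh.2 hθ0.ne'
  have hexp : Real.exp θ < r := by
    calc Real.exp θ < Real.exp (Real.log r) := Real.exp_lt_exp.2 (by linarith)
      _ = r := Real.exp_log (by linarith)
  set t := min (R / 2 * (Real.cosh θ - 1)) (r - 1) with ht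
  have ht0 : 0 < t := lt_min (mul_pos (by positivity) (by linarith)) (by linarith)
  have ht1 : t ≤ r - 1 := min_le_right _ _
  have ht2 : t ≤ R / 2 * (Real.cosh θ - 1) := min_le_left _ _
  have hr0 : 0 < r := by linarith
  set w : ℂ := ((1 - t / r : ℝ) : ℂ) * z₀ with hw
  have htr : t / r ≤ 1 := by rw [div_le_one hr0]; linarith
  have hwn : ‖w‖ = r - t := by
    rw [hw, norm_mul, Complex.norm_real, Real.norm_of_nonneg (by linarith), ← hrdef]
    field_simp
  have hwd : ‖w - z₀‖ = t := by
    have : w - z₀ = ((-(t / r) : ℝ) : ℂ) * z₀ := by rw [hw]; push_cast; ring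
    rw [this, norm_mul, Complex.norm_real, norm_neg, Real.norm_of_nonneg (by positivity), ← hrdef]
    field_simp
  refine ⟨max (r - t) (Real.exp θ), le_max_of_le_left (by linarith), max_lt (by linarith) hexp, ?_⟩
  intro n p ε hp h0 h1
  set m := max (r - t) (Real.exp θ) with hm
  have hm1 : 1 ≤ m := le_max_of_le_left (by linarith)
  have hε : 0 ≤ ε := (norm_nonneg _).trans (h1 z₀ hz₀)
  have hA := aux_bernstein n p (Polynomial.natDegree_le_iff_degree_le.2 hp) ε h0 w
    (by rw [hwn]; linarith)
  have hB := aux_walsh n K z₀ R hR hK (1 - p)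
    ((Polynomial.degree_sub_le _ _).trans (max_le (Polynomial.degree_one_le.trans (by positivity)) hp))
    ε (fun z hz => by simpa using h1 z hz) θ w (by rw [hwd]; exact ht2)
  have hA' : ‖p.eval w‖ ≤ ε * m ^ n := by
    refine hA.trans ?_
    rw [hwn]
    have : 0 ≤ r - t := by linarith
    gcongr
    exact le_max_left _ _
  have hB' : ‖(1 - p).eval w‖ ≤ ε * m ^ n := by
    refine hB.trans ?_
    gcongr
    calc Real.cosh (n * θ) ≤ Real.exp (n * θ) := by
          rw [Real.cosh_eq]
          have : Real.exp (-(n * θ)) ≤ Real.exp (n * θ) := Real.exp_le_exp.2 (by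
            have : 0 ≤ n * θ := by positivity
            linarith)
          linarith
      _ = Real.exp θ ^ n := Real.exp_nat_mul _ _
      _ ≤ m ^ n := by gcongr; exact le_max_right _ _
  have hone : (1 : ℝ) ≤ 2 * (ε * m ^ n) := by
    have : (1 : ℂ) = (1 - p).eval w + p.eval w := by simp
    calc (1 : ℝ) = ‖(1 : ℂ)‖ := by simp
      _ ≤ ‖(1 - p).eval w‖ + ‖p.eval w‖ := by
        conv_lhs => rw [this]
        exact norm_add_le _ _
      _ ≤ _ := by linarith
  have hmn : 0 < m ^ n := by positivity
  rw [one_div, one_div, inv_pow, ← div_eq_mul_inv, div_le_iff₀ hmn]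
  linarith

/-- For `L = D̄ ∪ K` as in Theorem 1.1, one has `1/dist(0,K) < ρ_L`. -/
theorem stmt8 (K : Set ℂ)
    (hKc : IsCompact K) (hKD : Disjoint K (Metric.closedBall (0:ℂ) 1))
    (hKnt : K.Nontrivial) (hKconn : IsConnected K) (hKcc : IsConnected Kᶜ)
    (F : ℂ → ℂ) (hF0 : ∀ z ∈ Metric.closedBall (0:ℂ) 1, F z = 0)
    (hF1 : ∀ z ∈ K, F z = 1) :
    1 / Metric.infDist (0:ℂ) K < rho (Metric.closedBall (0:ℂ) 1 ∪ K) F := by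
  obtain ⟨hr1, m, hm1, hmr, hmain⟩ := aux_lower K hKc hKD hKnt hKconn
  set L := Metric.closedBall (0:ℂ) 1 ∪ K with hL
  have hLc : IsCompact L := (isCompact_closedBall _ _).union hKc
  have hFb : ∀ z ∈ L, ‖F z‖ ≤ 1 := by
    rintro z (hz | hz)
    · simp [hF0 z hz]
    · simp [hF1 z hz]
  have hbdd : ∀ p : Polynomial ℂ,
      BddAbove ((fun z => ‖F z - Polynomial.eval z p‖) '' L) := by
    intro p
    obtain ⟨C, hC⟩ := hLc.exists_bound_of_continuousOn (f := fun z => Polynomial.eval z p)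
      p.continuous.continuousOn
    refine ⟨1 + C, ?_⟩
    rintro _ ⟨z, hz, rfl⟩
    exact (norm_sub_le _ _).trans (add_le_add (hFb z hz) (hC z hz))
  have hle : ∀ (p : Polynomial ℂ), ∀ z ∈ L, ‖F z - Polynomial.eval z p‖ ≤
      supNorm (fun z => F z - Polynomial.eval z p) L := fun p z hz =>
    le_csSup (hbdd p) ⟨z, hz, rfl⟩
  have hne : ∀ n : ℕ, {c : ℝ | ∃ p : Polynomial ℂ, p.degree ≤ (n : ℕ) ∧
      c = supNorm (fun z => F z - Polynomial.eval z p) L}.Nonempty :=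
    fun n => ⟨_, 0, by simp, rfl⟩
  have hlow : ∀ n : ℕ, 1 / 2 * (1 / m) ^ n ≤ dApprox L F n := by
    intro n
    refine le_csInf (hne n) ?_
    rintro _ ⟨p, hp, rfl⟩
    refine hmain n p _ hp ?_ ?_
    · intro z hz
      have := hle p z (Or.inl hz)
      rwa [hF0 z hz, zero_sub, norm_neg] at this
    · intro z hz
      have := hle p z (Or.inr hz)
      rwa [hF1 z hz] at this
  have hup : ∀ n : ℕ, dApprox L F n ≤ 1 := by
    intro n
    have h1 : dApprox L F n ≤ supNorm (fun z => F z - Polynomial.eval z 0) L := by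
      refine csInf_le ⟨0, ?_⟩ ⟨0, by simp, rfl⟩
      rintro _ ⟨p, hp, rfl⟩
      exact (norm_nonneg _).trans (hle p 0 (Or.inl (by simp)))
    refine h1.trans (csSup_le ⟨_, 0, Or.inl (by simp), rfl⟩ ?_)
    rintro _ ⟨z, hz, rfl⟩
    simpa using hFb z hz
  have hm0 : 0 < m := by linarith
  have hd0 : ∀ n : ℕ, 0 ≤ dApprox L F n := fun n => le_trans (by positivity) (hlow n)
  refine lt_of_lt_of_le (one_div_lt_one_div_of_lt hm0 hmr) ?_
  refine Filter.le_limsup_of_le ⟨1, ?_⟩ ?_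
  · rw [Filter.eventually_map]
    filter_upwards with n
    exact Real.rpow_le_one (hd0 n) (hup n) (by positivity)
  · intro b hb
    have hlim : Tendsto (fun n : ℕ => (1 / 2 : ℝ) ^ (1 / (n : ℝ)) * (1 / m)) atTop (𝓝 (1 / m)) := by
      have h1 : Tendsto (fun n : ℕ => (1 / 2 : ℝ) ^ (1 / (n : ℝ))) atTop (𝓝 ((1 / 2 : ℝ) ^ (0:ℝ))) :=
        (Real.continuousAt_const_rpow (by norm_num)).tendsto.comp tendsto_one_div_atTop_nhds_zero_nat
      simpa using h1.mul_const (1 / m)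
    refine le_of_tendsto hlim ?_
    filter_upwards [hb, eventually_gt_atTop 0] with n hn hn0
    refine le_trans ?_ hn
    calc (1 / 2 : ℝ) ^ (1 / (n : ℝ)) * (1 / m) = (1 / 2 * (1 / m) ^ n) ^ (1 / (n : ℝ)) := by
          rw [Real.mul_rpow (by norm_num) (by positivity), one_div (n : ℝ),
            Real.pow_rpow_inv_natCast (by positivity) hn0.ne']
      _ ≤ _ := Real.rpow_le_rpow (by positivity) (hlow n) (by positivity)
end

section
/- For every real number a ≥ 18, the set U(0, D, D̄(a,1), (2^n)) is nonempty; that is, there exists a function f holomorphic on the open unit disc D such that the sequence (2^n·S_n(f,0))_{n≥1}, restricted to the closed disc D̄(a,1), is dense in A(D̄(a,1)) with respect to the supremum norm. -/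
open Filter Topology Metric

/-- The universal class `U(0, D, K, (β_n))` of functions `f` holomorphic in the open unit
disc `D` such that `{β_n · S_n(f,0)|_K : n ≥ 1}` is dense in `A(K)` for the sup norm on `K`. -/
def UD (K : Set ℂ) (β : ℕ → ℂ) : Set (ℂ → ℂ) :=
  {f | DifferentiableOn ℂ f (Metric.ball 0 1) ∧ ∀ h : ℂ → ℂ, memA K h → ∀ ε : ℝ, 0 < ε →
    ∃ n : ℕ, 1 ≤ n ∧ supNorm (fun z => β n * taylorSum f 0 n z - h z) K < ε}

open Polynomial in
/-- the truncated negative binomial series, multiplied by `(X/a)^(m+1)`. -/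
noncomputable def kern (a : ℝ) (m L : ℕ) : ℂ[X] :=
  (C ((a : ℂ)⁻¹) * X) ^ (m + 1) *
    ∑ n ∈ Finset.range (L + 1), C ((n + m).choose m : ℂ) * (1 - C ((a : ℂ)⁻¹) * X) ^ n

open Polynomial in
lemma kern_eval (a : ℝ) (m L : ℕ) (z : ℂ) : (kern a m L).eval z =
    (z / a) ^ (m + 1) * ∑ n ∈ Finset.range (L + 1), ((n + m).choose m : ℂ) * (1 - z / a) ^ n := by
  simp only [kern, eval_mul, eval_pow, eval_C, eval_X, eval_finsetSum, eval_sub, eval_one]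
  rw [div_eq_inv_mul]

open Polynomial in
lemma kern_dvd (a : ℝ) (m L : ℕ) : X ^ (m + 1) ∣ kern a m L := by
  unfold kern
  rw [mul_pow]
  exact Dvd.dvd.mul_right (Dvd.intro_left _ rfl) _

open Polynomial in
lemma kern_deg (a : ℝ) (m L : ℕ) : (kern a m L).natDegree ≤ m + 1 + L := by
  have h1 : (C ((a : ℂ)⁻¹) * X).natDegree ≤ 1 := (natDegree_C_mul_le _ _).trans natDegree_X_le
  have h2 : (1 - C ((a : ℂ)⁻¹) * X).natDegree ≤ 1 := by
    refine (natDegree_sub_le _ _).trans ?_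
    simpa using h1
  unfold kern
  refine natDegree_mul_le.trans (add_le_add ?_ ?_)
  · refine natDegree_pow_le.trans ?_
    nlinarith
  · refine natDegree_sum_le_of_forall_le _ _ ?_
    intro n hn
    refine natDegree_C_mul_le _ _ |>.trans (natDegree_pow_le.trans ?_)
    have := Finset.mem_range.1 hn
    nlinarith

lemma choose_bd (n m : ℕ) : ‖((n + m).choose m : ℂ)‖ ≤ 2 ^ (n + m) := by
  rw [Complex.norm_natCast]
  exact_mod_cast Nat.choose_le_two_pow (n + m) m

lemma kern_small (a : ℝ) (ha : 18 ≤ a) (m L : ℕ) (hL : L ≤ m) (z : ℂ) (hz : ‖z‖ ≤ 1) :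
    ‖(kern a m L).eval z‖ ≤ (4 * (a + 1) / a ^ 2) ^ (m + 1) := by
  have ha0 : 0 < a := by linarith
  have hza : ‖z / a‖ ≤ 1 / a := by
    rw [norm_div, Complex.norm_real, Real.norm_of_nonneg ha0.le]; gcongr
  have h1 : ‖1 - z / a‖ ≤ (a + 1) / a := by
    calc ‖1 - z / a‖ ≤ ‖(1 : ℂ)‖ + ‖z / a‖ := norm_sub_le _ _
      _ ≤ 1 + 1 / a := by simp only [norm_one]; gcongr
      _ = _ := by field_simp
  have hq : 2 ≤ 2 * ((a + 1) / a) := by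
    have : 1 ≤ (a + 1) / a := by rw [le_div_iff₀ ha0]; linarith
    linarith
  have hgeom : ∀ K : ℕ, ∑ n ∈ Finset.range K, (2 * ((a + 1) / a)) ^ n ≤ (2 * ((a + 1) / a)) ^ K := by
    intro K
    induction K with
    | zero => simp
    | succ K ih =>
      rw [Finset.sum_range_succ, pow_succ]
      have : 0 ≤ (2 * ((a + 1) / a)) ^ K := by positivity
      nlinarith
  have hs : ‖∑ n ∈ Finset.range (L + 1), ((n + m).choose m : ℂ) * (1 - z / a) ^ n‖ ≤
      2 ^ m * (2 * ((a + 1) / a)) ^ (m + 1) := by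
    calc _ ≤ ∑ n ∈ Finset.range (L + 1), 2 ^ m * (2 * ((a + 1) / a)) ^ n := by
          refine norm_sum_le_of_le _ fun n _ => ?_
          rw [norm_mul, norm_pow]
          calc _ ≤ 2 ^ (n + m) * ((a + 1) / a) ^ n := by
                gcongr
                exact choose_bd n m
            _ = _ := by rw [mul_pow, pow_add]; ring
      _ = 2 ^ m * ∑ n ∈ Finset.range (L + 1), (2 * ((a + 1) / a)) ^ n := by rw [Finset.mul_sum]
      _ ≤ 2 ^ m * (2 * ((a + 1) / a)) ^ (L + 1) := by gcongr; exact hgeom _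
      _ ≤ _ := by
        gcongr
        linarith
  rw [kern_eval, norm_mul, norm_pow]
  calc _ ≤ (1 / a) ^ (m + 1) * (2 ^ m * (2 * ((a + 1) / a)) ^ (m + 1)) := by gcongr
    _ ≤ (1 / a) ^ (m + 1) * (2 ^ (m + 1) * (2 * ((a + 1) / a)) ^ (m + 1)) := by
      gcongr <;> norm_num
    _ = _ := by
      rw [← mul_pow, ← mul_pow]; congr 1; field_simp; ring

lemma kern_close (a : ℝ) (ha : 18 ≤ a) (m L : ℕ) (z : ℂ) (hz : ‖z - a‖ ≤ 1) :
    ‖1 - (kern a m L).eval z‖ ≤ ((a + 1) / a) ^ (m + 1) * (2 ^ (m + 1) * (2 / a) ^ (L + 1)) := by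
  have ha0 : 0 < a := by linarith
  have hac : (a : ℂ) ≠ 0 := by exact_mod_cast ha0.ne'
  have hza : ‖z / a‖ ≤ (a + 1) / a := by
    rw [norm_div, Complex.norm_real, Real.norm_of_nonneg ha0.le]
    gcongr
    calc ‖z‖ = ‖a + (z - a)‖ := by ring_nf
      _ ≤ ‖(a : ℂ)‖ + ‖z - a‖ := norm_add_le _ _
      _ ≤ _ := by rw [Complex.norm_real, Real.norm_of_nonneg ha0.le]; linarith
  have h1 : ‖1 - z / a‖ ≤ 1 / a := by
    have : 1 - z / a = - ((z - a) / a) := by field_simp; ring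
    rw [this, norm_neg, norm_div, Complex.norm_real, Real.norm_of_nonneg ha0.le]; gcongr
  have hlt : ‖1 - z / a‖ < 1 := by
    refine h1.trans_lt ?_
    rw [div_lt_one ha0]; linarith
  have hz0 : z / a ≠ 0 := by
    intro h; rw [h] at hlt; simp at hlt
  have H := hasSum_choose_mul_geometric_of_norm_lt_one m hlt
  rw [sub_sub_cancel] at H
  have hr : (2 / a) < 1 := by rw [div_lt_one ha0]; linarith
  have htail : ‖1 / (z / a) ^ (m + 1) - ∑ n ∈ Finset.range (L + 1), ((n + m).choose m : ℂ) * (1 - z / a) ^ n‖ ≤ 2 ^ (m + 1) * (2 / a) ^ (L + 1) := by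
    have H2 := (hasSum_nat_add_iff' (L + 1)).2 H
    rw [← H2.tsum_eq]
    have G : HasSum (fun n : ℕ => 2 ^ m * (2 / a) ^ (L + 1) * (2 / a) ^ n)
        (2 ^ m * (2 / a) ^ (L + 1) * (1 - 2 / a)⁻¹) :=
      (hasSum_geometric_of_lt_one (by positivity) hr).mul_left _
    refine (tsum_of_norm_bounded G ?_).trans ?_
    · intro n
      rw [norm_mul, norm_pow]
      calc _ ≤ 2 ^ (n + (L + 1) + m) * (1 / a) ^ (n + (L + 1)) := by
            gcongr
            exact choose_bd _ m
        _ = _ := by simp only [div_pow, pow_add, one_pow]; field_simp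
    · have : (1 - 2 / a)⁻¹ ≤ 2 := by
        have h3 : 2 / a ≤ 1 / 2 := by rw [div_le_iff₀ ha0]; linarith
        rw [inv_le_comm₀ (by linarith) (by norm_num)]
        linarith
      calc _ ≤ 2 ^ m * (2 / a) ^ (L + 1) * 2 := by gcongr
        _ = _ := by ring
  rw [kern_eval]
  have : 1 - (z / a) ^ (m + 1) * ∑ n ∈ Finset.range (L + 1), ((n + m).choose m : ℂ) * (1 - z / a) ^ n
      = (z / a) ^ (m + 1) * (1 / (z / a) ^ (m + 1) - ∑ n ∈ Finset.range (L + 1), ((n + m).choose m : ℂ) * (1 - z / a) ^ n) := by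
    rw [mul_sub, mul_one_div_cancel (pow_ne_zero _ hz0)]
  rw [this, norm_mul, norm_pow]
  gcongr

open Polynomial in
lemma poly_bound (P : ℂ[X]) (R : ℝ) : ∃ B : ℝ, 0 ≤ B ∧ ∀ z : ℂ, ‖z‖ ≤ R → ‖P.eval z‖ ≤ B := by
  obtain ⟨B, hB⟩ := (isCompact_closedBall (0 : ℂ) R).exists_bound_of_continuousOn
    (f := fun z => P.eval z) P.continuous.continuousOn
  exact ⟨max B 0, le_max_right _ _, fun z hz => (hB z (by simpa using hz)).trans (le_max_left _ _)⟩

open Polynomial in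
lemma step (a : ℝ) (ha : 18 ≤ a) (P g : ℂ[X]) (N : ℕ) (ε : ℝ) (hε : 0 < ε) :
    ∃ (Q : ℂ[X]) (n : ℕ), N < n ∧ X ^ (N + 1) ∣ Q ∧ Q.natDegree ≤ n ∧
      (∀ z : ℂ, ‖z‖ ≤ 1 → ‖Q.eval z‖ ≤ ε) ∧
      ∀ z : ℂ, ‖z - a‖ ≤ 1 → ‖2 ^ n * (P + Q).eval z - g.eval z‖ ≤ ε := by
  have ha0 : 0 < a := by linarith
  obtain ⟨B1, hB1, hP⟩ := poly_bound P (a + 1)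
  obtain ⟨B2, hB2, hg⟩ := poly_bound g (a + 1)
  set B := B1 + B2 with hB
  set d := max P.natDegree g.natDegree with hd
  have hθ1 : 4 * (a + 1) / a ^ 2 < 1 := by rw [div_lt_one (by positivity)]; nlinarith
  have hθ2 : 16 * (a + 1) / a ^ 2 < 1 := by rw [div_lt_one (by positivity)]; nlinarith
  have t1 : Tendsto (fun m : ℕ => B * (4 * (a + 1) / a ^ 2) ^ (m + 1)) atTop (𝓝 0) := by
    simpa using ((tendsto_pow_atTop_nhds_zero_of_lt_one (by positivity) hθ1).comp
      (tendsto_add_atTop_nat 1)).const_mul B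
  have t2 : Tendsto (fun m : ℕ => B * (a / 2) ^ d * (16 * (a + 1) / a ^ 2) ^ (m + 1)) atTop (𝓝 0) := by
    simpa using ((tendsto_pow_atTop_nhds_zero_of_lt_one (by positivity) hθ2).comp
      (tendsto_add_atTop_nat 1)).const_mul (B * (a / 2) ^ d)
  obtain ⟨m, hm1, hm2, hm3⟩ := ((t1.eventually_le_const hε).and
    ((t2.eventually_le_const hε).and (eventually_ge_atTop (N + d)))).exists
  obtain ⟨L, rfl⟩ : ∃ L, m = L + d := ⟨m - d, by omega⟩
  set m := L + d with hm
  set n := 2 * (m + 1) with hn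
  have hdiff : ∀ z : ℂ, ‖z‖ ≤ a + 1 → ‖((2 : ℂ) ^ n)⁻¹ * g.eval z - P.eval z‖ ≤ B := by
    intro z hz
    have h1 : ‖((2 : ℂ) ^ n)⁻¹‖ ≤ 1 := by
      rw [norm_inv, norm_pow, Complex.norm_ofNat]
      exact inv_le_one_of_one_le₀ (one_le_pow₀ (by norm_num))
    calc _ ≤ ‖((2 : ℂ) ^ n)⁻¹ * g.eval z‖ + ‖P.eval z‖ := norm_sub_le _ _
      _ ≤ 1 * B2 + B1 := by
        rw [norm_mul]
        gcongr
        · exact hg z hz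
        · exact hP z hz
      _ = B := by rw [hB]; ring
  refine ⟨(C ((2 : ℂ) ^ n)⁻¹ * g - P) * kern a m L, n, by omega, ?_, ?_, ?_, ?_⟩
  · exact Dvd.dvd.mul_left ((pow_dvd_pow X (by omega)).trans (kern_dvd a m L)) _
  · refine natDegree_mul_le.trans ?_
    have h1 := kern_deg a m L
    have h2 : (C ((2 : ℂ) ^ n)⁻¹ * g - P).natDegree ≤ d := by
      refine (natDegree_sub_le _ _).trans (max_le ?_ (le_max_left _ _))
      exact (natDegree_C_mul_le _ _).trans (le_max_right _ _)
    omega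
  · intro z hz
    rw [eval_mul, norm_mul]
    refine le_trans ?_ hm1
    gcongr
    · simpa using hdiff z (by linarith)
    · exact kern_small a ha m L (by omega) z hz
  · intro z hz
    have hza : ‖z‖ ≤ a + 1 := by
      calc ‖z‖ = ‖a + (z - a)‖ := by ring_nf
        _ ≤ ‖(a : ℂ)‖ + ‖z - a‖ := norm_add_le _ _
        _ ≤ _ := by rw [Complex.norm_real, Real.norm_of_nonneg ha0.le]; linarith
    have h2 : (2 : ℂ) ^ n ≠ 0 := pow_ne_zero _ two_ne_zero
    have e : 2 ^ n * (P + (C ((2 : ℂ) ^ n)⁻¹ * g - P) * kern a m L).eval z - g.eval z =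
        - (2 ^ n * ((((2 : ℂ) ^ n)⁻¹ * g.eval z - P.eval z) * (1 - (kern a m L).eval z))) := by
      simp only [eval_add, eval_mul, eval_sub, eval_C]
      field_simp
      ring
    rw [e, norm_neg, norm_mul, norm_mul, norm_pow, Complex.norm_ofNat]
    refine le_trans ?_ hm2
    calc _ ≤ 2 ^ n * (B * (((a + 1) / a) ^ (m + 1) * (2 ^ (m + 1) * (2 / a) ^ (L + 1)))) := by
          gcongr
          · exact hdiff z hza
          · exact kern_close a ha m L z hz
      _ = _ := by
        have : (2 / a) ^ (L + 1) = (a / 2) ^ d * (2 / a) ^ (m + 1) := by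
          have : m + 1 = d + (L + 1) := by omega
          rw [this, pow_add _ d, ← mul_assoc, ← mul_pow]
          have : a / 2 * (2 / a) = 1 := by field_simp
          rw [this]; simp
        rw [this, hn, pow_mul]
        have : (16 * (a + 1) / a ^ 2) = 2 ^ 2 * ((a + 1) / a) * 2 * (2 / a) := by field_simp; norm_num
        rw [this]
        simp only [mul_pow]
        ring

open Polynomial in
lemma poly_dense (a : ℝ) (h : ℂ → ℂ) (hh : memA (closedBall (a : ℂ) 1) h) (ε : ℝ) (hε : 0 < ε) :
    ∃ p : ℂ[X], ∀ z ∈ closedBall (a : ℂ) 1, ‖p.eval z - h z‖ < ε := by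
  obtain ⟨hc, hd⟩ := hh
  rw [interior_closedBall _ one_ne_zero] at hd
  have hdc : DiffContOnCl ℂ h (ball (a : ℂ) ((1 : NNReal) : ℝ)) := by
    refine ⟨by simpa using hd, ?_⟩
    rw [closure_ball _ (by simp)]; simpa using hc
  have hps := hdc.hasFPowerSeriesOnBall (by norm_num)
  have huc := (isCompact_closedBall (a : ℂ) 1).uniformContinuousOn_of_continuous hc
  rw [Metric.uniformContinuousOn_iff] at huc
  obtain ⟨δ, hδ, huc⟩ := huc (ε / 2) (by linarith)
  obtain ⟨r, hr0, hr1, hrδ⟩ : ∃ r : ℝ, 0 < r ∧ r < 1 ∧ 1 - r < δ := by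
    refine ⟨max (1 / 2) (1 - δ / 2), ?_, ?_, ?_⟩
    · exact lt_max_of_lt_left (by norm_num)
    · exact max_lt (by norm_num) (by linarith)
    · have := le_max_right (1 / 2) (1 - δ / 2); linarith
  obtain ⟨s, hrs, hs1⟩ := exists_between hr1
  have hs0 : 0 < s := hr0.trans hrs
  have hu := hps.tendstoUniformlyOn (r' := s.toNNReal) (by
    rw [ENNReal.coe_lt_coe, Real.toNNReal_lt_one]; exact hs1)
  rw [Real.coe_toNNReal _ hs0.le] at hu
  rw [Metric.tendstoUniformlyOn_iff] at hu
  obtain ⟨n, hn⟩ := (hu (ε / 2) (by linarith)).exists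
  set p := cauchyPowerSeries h (a : ℂ) ((1 : NNReal) : ℝ)
  refine ⟨∑ k ∈ Finset.range n, C (p.coeff k) * (C (r : ℂ) * (X - C (a : ℂ))) ^ k, ?_⟩
  intro z hz
  rw [mem_closedBall, dist_eq_norm] at hz
  have hy : ‖(r : ℂ) * (z - a)‖ ≤ r := by
    rw [norm_mul, Complex.norm_real, Real.norm_of_nonneg hr0.le]; nlinarith
  have h1 := hn ((r : ℂ) * (z - a)) (by
    rw [mem_ball_zero_iff]; exact hy.trans_lt hrs)
  have h2 := huc (a + (r : ℂ) * (z - a)) (by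
    rw [mem_closedBall, dist_eq_norm, add_sub_cancel_left]; linarith) z (by
    rw [mem_closedBall, dist_eq_norm]; exact hz) (by
    rw [dist_eq_norm]
    have : (a + (r : ℂ) * (z - a)) - z = - (((1 - r : ℝ) : ℂ) * (z - a)) := by push_cast; ring
    rw [this, norm_neg, norm_mul, Complex.norm_real, Real.norm_of_nonneg (by linarith)]
    nlinarith)
  have e : (∑ k ∈ Finset.range n, C (p.coeff k) * (C (r : ℂ) * (X - C (a : ℂ))) ^ k).eval z
      = p.partialSum n ((r : ℂ) * (z - a)) := by
    simp [eval_finsetSum, FormalMultilinearSeries.partialSum, mul_comm, mul_pow]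
  rw [e, ← dist_eq_norm]
  calc _ ≤ dist (p.partialSum n ((r : ℂ) * (z - a))) (h (a + (r : ℂ) * (z - a))) + _ := dist_triangle _ _ _
    _ < ε / 2 + ε / 2 := by rw [dist_comm] at h1; exact add_lt_add h1 h2
    _ = ε := by ring

open Polynomial in
lemma poly_seq (a : ℝ) : ∃ g : ℕ → ℂ[X], ∀ h : ℂ → ℂ, memA (closedBall (a : ℂ) 1) h →
    ∀ ε : ℝ, 0 < ε → ∃ i, ∀ z ∈ closedBall (a : ℂ) 1, ‖(g i).eval z - h z‖ < ε := by
  have : CompactSpace (closedBall (a : ℂ) 1) := isCompact_iff_compactSpace.1 (isCompact_closedBall _ _)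
  let S : Set C(closedBall (a : ℂ) 1, ℂ) := Set.range (fun p : ℂ[X] => p.toContinuousMapOn (closedBall (a : ℂ) 1))
  have : Nonempty S := ⟨⟨_, 0, rfl⟩⟩
  choose g hg using fun i => (TopologicalSpace.denseSeq S i).2
  refine ⟨g, fun h hh ε hε => ?_⟩
  obtain ⟨p, hp⟩ := poly_dense a h hh (ε / 2) (by linarith)
  obtain ⟨i, hi⟩ := (TopologicalSpace.denseRange_denseSeq S).exists_dist_lt
    (⟨_, p, rfl⟩ : S) (ε := ε / 2) (by linarith)
  refine ⟨i, fun z hz => ?_⟩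
  rw [Subtype.dist_eq, ← hg i] at hi
  have h1 := (ContinuousMap.dist_apply_le_dist (⟨z, hz⟩ : closedBall (a : ℂ) 1)).trans_lt hi
  have h1' : dist (p.eval z) ((g i).eval z) < ε / 2 := h1
  have h2 := hp z hz
  rw [← dist_eq_norm] at h2 ⊢
  rw [dist_comm] at h1'
  linarith [dist_triangle ((g i).eval z) (p.eval z) (h z)]

open Polynomial in
lemma iter_lim (P : ℕ → ℂ[X]) (f : ℂ → ℂ)
    (h : TendstoLocallyUniformlyOn (fun i z => (P i).eval z) f atTop (ball 0 1)) (k : ℕ) :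
    TendstoLocallyUniformlyOn (fun i z => (derivative^[k] (P i)).eval z) (iteratedDeriv k f) atTop
      (ball 0 1) := by
  induction k with
  | zero => simpa using h
  | succ k ih =>
    have := ih.deriv (Eventually.of_forall fun i => (derivative^[k] (P i)).differentiable.differentiableOn) isOpen_ball
    rw [iteratedDeriv_succ]
    refine this.congr ?_
    intro i z _
    simp [Function.iterate_succ_apply']

/-- For every real `a ≥ 18`, `U(0, D, D̄(a,1), (2ⁿ)) ≠ ∅`. -/
theorem stmt10 (a : ℝ) (ha : 18 ≤ a) :
    (UD (Metric.closedBall ((a : ℂ)) 1) (fun n => (2 : ℂ) ^ n)).Nonempty := by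
  obtain ⟨g, hg⟩ := poly_seq a
  choose Q n hn hdvd hdeg hsmall hclose using fun (P g : Polynomial ℂ) (N : ℕ) (i : ℕ) =>
    step a ha P g N ((1 / 2 : ℝ) ^ i) (by positivity)
  -- the recursive construction
  let st : ℕ → Polynomial ℂ × ℕ := fun i => Nat.rec (0, 0)
    (fun i s => (s.1 + Q s.1 (g i.unpair.1) s.2 i, n s.1 (g i.unpair.1) s.2 i)) i
  let P : ℕ → Polynomial ℂ := fun i => (st i).1
  let N : ℕ → ℕ := fun i => (st i).2
  let R : ℕ → Polynomial ℂ := fun i => Q (P i) (g i.unpair.1) (N i) i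
  have hP0 : P 0 = 0 := rfl
  have hPs : ∀ i, P (i + 1) = P i + R i := fun i => rfl
  have hNs : ∀ i, N (i + 1) = n (P i) (g i.unpair.1) (N i) i := fun i => rfl
  have hNlt : ∀ i, N i < N (i + 1) := fun i => hn _ _ _ _
  have hNmono : StrictMono N := strictMono_nat_of_lt_succ hNlt
  have hPdeg : ∀ i, (P i).natDegree ≤ N i := by
    intro i
    induction i with
    | zero => simp [hP0]
    | succ i ih =>
      rw [hPs]
      refine (Polynomial.natDegree_add_le _ _).trans (max_le (ih.trans (hNlt i).le) (hdeg _ _ _ _))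
  have hcoeff : ∀ i j k, k ≤ N i → i ≤ j → (P j).coeff k = (P i).coeff k := by
    intro i j k hk hij
    induction j, hij using Nat.le_induction with
    | base => rfl
    | succ j hij ih =>
      rw [hPs, Polynomial.coeff_add, ih]
      have := (Polynomial.X_pow_dvd_iff.1 (hdvd (P j) (g j.unpair.1) (N j) j)) k
        (by have := hNmono.monotone hij; omega)
      simp [R, this]
  let f : ℂ → ℂ := fun z => ∑' i, (R i).eval z
  have hlim : TendstoLocallyUniformlyOn (fun i z => (P i).eval z) f atTop (ball 0 1) := by
    have hsum : Summable (fun i : ℕ => (1 / 2 : ℝ) ^ i) := summable_geometric_two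
    have := tendstoUniformlyOn_tsum_nat (f := fun i z => (R i).eval z) (s := ball (0 : ℂ) 1) hsum
      (fun i z hz => hsmall _ _ _ _ z (by rw [mem_ball_zero_iff] at hz; exact hz.le))
    refine (this.congr (Eventually.of_forall fun i z _ => ?_)).tendstoLocallyUniformlyOn
    have : ∀ i, P i = ∑ j ∈ Finset.range i, R j := by
      intro i
      induction i with
      | zero => simp [hP0]
      | succ i ih => rw [hPs, Finset.sum_range_succ, ih]
    simp only [this i, Polynomial.eval_finsetSum]
  have hdiff : DifferentiableOn ℂ f (ball 0 1) :=
    hlim.differentiableOn (Eventually.of_forall fun i => (P i).differentiable.differentiableOn) isOpen_ball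
  have htc : ∀ i k, k ≤ N i → iteratedDeriv k f 0 / (Nat.factorial k) = (P i).coeff k := by
    intro i k hk
    have h1 := (iter_lim P f hlim k).tendsto_at (a := 0) (by simp)
    have h2 : Tendsto (fun j => (Polynomial.derivative^[k] (P j)).eval 0) atTop
        (𝓝 ((Nat.factorial k : ℂ) * (P i).coeff k)) := by
      refine tendsto_const_nhds.congr' ?_
      filter_upwards [eventually_ge_atTop i] with j hj
      rw [← Polynomial.coeff_zero_eq_eval_zero, Polynomial.coeff_iterate_derivative,
        zero_add, hcoeff i j k hk hj, Nat.descFactorial_self, nsmul_eq_mul]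
    rw [tendsto_nhds_unique h1 h2]
    exact mul_div_cancel_left₀ _ (Nat.cast_ne_zero.2 (Nat.factorial_ne_zero k))
  have htaylor : ∀ i z, taylorSum f 0 (N i) z = (P i).eval z := by
    intro i z
    rw [taylorSum, Polynomial.eval_eq_sum_range' (Nat.lt_succ_of_le (hPdeg i))]
    refine Finset.sum_congr rfl fun k hk => ?_
    rw [htc i k (Nat.lt_succ_iff.1 (Finset.mem_range.1 hk)), sub_zero]
  refine ⟨f, hdiff, fun h hh ε hε => ?_⟩
  obtain ⟨i, hi⟩ := hg h hh (ε / 3) (by linarith)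
  obtain ⟨k, hk⟩ := exists_pow_lt_of_lt_one (show 0 < ε / 3 by linarith) (show (1 / 2 : ℝ) < 1 by norm_num)
  set j := Nat.pair i k with hj
  have hkj : k ≤ j := Nat.right_le_pair i k
  refine ⟨N (j + 1), by have := hNlt j; omega, ?_⟩
  refine lt_of_le_of_lt (b := 2 * (ε / 3)) ?_ (by linarith)
  refine csSup_le ((nonempty_closedBall.2 zero_le_one).image _) ?_
  rintro _ ⟨z, hz, rfl⟩
  have h1 := hclose (P j) (g j.unpair.1) (N j) j z (by rwa [mem_closedBall, dist_eq_norm] at hz)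
  have hju : j.unpair.1 = i := by rw [hj, Nat.unpair_pair]
  have h2 := hi z hz
  have h3 : (1 / 2 : ℝ) ^ j ≤ (1 / 2 : ℝ) ^ k := pow_le_pow_of_le_one (by norm_num) (by norm_num) hkj
  have e : (2 : ℂ) ^ N (j + 1) * taylorSum f 0 (N (j + 1)) z - h z =
      (2 ^ N (j + 1) * (P (j + 1)).eval z - (g i).eval z) + ((g i).eval z - h z) := by
    linear_combination (2 : ℂ) ^ N (j + 1) * htaylor (j + 1) z
  have h1' : ‖(2 : ℂ) ^ N (j + 1) * (P (j + 1)).eval z - (g i).eval z‖ ≤ (1 / 2 : ℝ) ^ j := by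
    rw [← hju]; exact h1
  simp only [e]
  refine (norm_add_le _ _).trans ?_
  linarith
end
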